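/- arXiv:2605.25137 — 5 statements merged into one kernel-verified Lean document; each statement's English description precedes it below -/
import Mathlib

section
/- Let 0 < α < π/2, a = π/2 - α, b = π/2 + α. For every f ∈ H¹(a,b) with ∫ₐᵇ f(φ) sin φ dφ = 0, one has ∫ₐᵇ f(φ)² sin φ dφ ≤ C_{α,A} ∫ₐᵇ f'(φ)² sin φ dφ, where C_{α,A} = 4α²/(π² + 2α²). In particular C_{π/6,A} = 2/19. -/
open MeasureTheory Real Set

/-- Derivative of the Picone multiplier. -/
lemma picone_h (ν x : ℝ) (hs : sin x ≠ 0) (hc : cos (ν * (x - π/2)) ≠ 0) :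
    HasDerivAt (fun y => (cos y / (2 * sin y) - ν * tan (ν * (y - π/2))) / sin y)
      (((-1 / (2 * sin x ^ 2) - ν^2 * (1 + tan (ν * (x - π/2)) ^ 2)) * sin x
        - (cos x / (2 * sin x) - ν * tan (ν * (x - π/2))) * cos x) / sin x ^ 2) x := by
  have h1 : HasDerivAt (fun y => cos y / (2 * sin y)) (-1 / (2 * sin x ^ 2)) x := by
    have := (hasDerivAt_cos x).div ((hasDerivAt_sin x).const_mul 2) (by positivity)
    refine this.congr_deriv ?_
    field_simp
    nlinarith [sin_sq_add_cos_sq x]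
  have h2 : HasDerivAt (fun y => ν * (y - π/2)) ν x := by
    simpa using ((hasDerivAt_id x).sub_const (π/2)).const_mul ν
  have h3 : HasDerivAt (fun y => ν * tan (ν * (y - π/2)))
      (ν^2 * (1 + tan (ν * (x - π/2)) ^ 2)) x := by
    have := ((hasDerivAt_tan hc).comp x h2).const_mul ν
    refine this.congr_deriv ?_
    rw [tan_eq_sin_div_cos]
    have hsc := sin_sq_add_cos_sq (ν * (x - π/2))
    generalize ν * (x - π/2) = z at hc hsc ⊢
    field_simp
    nlinarith [hsc]
  exact (h1.sub h3).div (hasDerivAt_sin x) hs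

/-- The pointwise inequality. -/
lemma picone_alg (ν s c T u g d : ℝ) (hs : 0 < s) (hsc : s^2 + c^2 = 1) :
    (ν^2 + 1/2) * (g^2 * s) - d^2 * s ≤
      (ν^2 + 1/2) * (2 * (d * u + g * (g * s)) - (2 * u * (g * s) * ((c / (2 * s) - ν * T) / s)
        + u^2 * (((-1 / (2 * s ^ 2) - ν^2 * (1 + T ^ 2)) * s
        - (c / (2 * s) - ν * T) * c) / s ^ 2))) := by
  set L := ν^2 + 1/2 with hL
  have hLpos : 0 < L := by positivity
  set h := (c / (2 * s) - ν * T) / s with hh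
  set h' := (((-1 / (2 * s ^ 2) - ν^2 * (1 + T ^ 2)) * s
        - (c / (2 * s) - ν * T) * c) / s ^ 2) with hh'
  have key : -h' - s * h^2 = L / s + (3 * c^2 / (4 * s^2)) / s := by
    rw [hh, hh', hL]
    have : c^2 = 1 - s^2 := by linarith
    field_simp
    ring_nf
    simp only [this]
    ring
  have e : L * (2 * (d * u + g * (g * s)) - (2 * u * (g * s) * h + u^2 * h'))
      - (L * (g^2 * s) - d^2 * s) = L * s * (g - u * h)^2 + L * u^2 * ((3 * c^2 / (4 * s^2)) / s)
        + s * (d + L * u / s)^2 := by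
    have : h' = - (L / s + (3 * c^2 / (4 * s^2)) / s) - s * h^2 := by linarith
    rw [this]
    field_simp
    ring
  have : 0 ≤ L * s * (g - u * h)^2 + L * u^2 * ((3 * c^2 / (4 * s^2)) / s)
        + s * (d + L * u / s)^2 := by positivity
  linarith

lemma poincare_sub (α : ℝ) (hα : 0 < α) (hα' : α < π/2)
    (f f' : ℝ → ℝ)
    (hderiv : ∀ x ∈ Set.Icc (π/2 - α) (π/2 + α), HasDerivAt f (f' x) x)
    (hf2 : IntervalIntegrable (fun x => f x ^ 2 * Real.sin x) volume (π/2 - α) (π/2 + α))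
    (hf'2 : IntervalIntegrable (fun x => f' x ^ 2 * Real.sin x) volume (π/2 - α) (π/2 + α))
    (hmean : (∫ x in (π/2 - α)..(π/2 + α), f x * Real.sin x) = 0)
    (ν : ℝ) (hν : 0 < ν) (hν' : ν * α < π / 2) :
    (ν^2 + 1/2) * (∫ x in (π/2 - α)..(π/2 + α), f x ^ 2 * Real.sin x)
      ≤ ∫ x in (π/2 - α)..(π/2 + α), f' x ^ 2 * Real.sin x := by
  set a := π/2 - α with ha
  set b := π/2 + α with hb
  have hab : a ≤ b := by linarith
  have hspos : ∀ x ∈ Icc a b, 0 < sin x := fun x hx =>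
    sin_pos_of_pos_of_lt_pi (by linarith [hx.1]) (by linarith [hx.2])
  have hcpos : ∀ x ∈ Icc a b, 0 < cos (ν * (x - π/2)) := fun x hx => by
    apply cos_pos_of_mem_Ioo
    constructor <;> nlinarith [hx.1, hx.2]
  have hfc : ContinuousOn f (Icc a b) := fun x hx => (hderiv x hx).continuousAt.continuousWithinAt
  have hgc : ContinuousOn (fun x => f x * sin x) (Icc a b) := hfc.mul continuous_sin.continuousOn
  have hgi : IntervalIntegrable (fun x => f x * sin x) volume a b :=
    hgc.intervalIntegrable_of_Icc hab
  set U : ℝ → ℝ := fun x => ∫ t in a..x, f t * sin t with hU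
  have hUa : U a = 0 := by simp [hU]
  have hUb : U b = 0 := hmean
  have hUc : ContinuousOn U (Icc a b) := by
    have := intervalIntegral.continuousOn_primitive_interval (μ := volume)
      (f := fun x => f x * sin x) (a := a) (b := b)
      (by rw [uIcc_of_le hab]; exact hgc.integrableOn_Icc)
    rwa [uIcc_of_le hab] at this
  have hUd : ∀ x ∈ Ioo a b, HasDerivAt U (f x * sin x) x := fun x hx => by
    have hsub : Icc a x ⊆ Icc a b := Icc_subset_Icc_right hx.2.le
    refine intervalIntegral.integral_hasDerivAt_right
      ((hgc.mono hsub).intervalIntegrable_of_Icc hx.1.le) ?_ ?_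
    · exact (hgc.mono Ioo_subset_Icc_self).stronglyMeasurableAtFilter isOpen_Ioo x hx
    · exact hgc.continuousAt (Icc_mem_nhds hx.1 hx.2)
  have hhd := fun x (hx : x ∈ Icc a b) => picone_h ν x (hspos x hx).ne' (hcpos x hx).ne'
  set h : ℝ → ℝ := fun y => (cos y / (2 * sin y) - ν * tan (ν * (y - π/2))) / sin y with hh
  have hhc : ContinuousOn h (Icc a b) := fun x hx => (hhd x hx).continuousAt.continuousWithinAt
  have main := intervalIntegral.integral_le_sub_of_hasDeriv_right_of_le hab
    (g := fun x => (ν^2 + 1/2) * (2 * (f x * U x) - U x ^ 2 * h x))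
    (φ := fun x => (ν^2 + 1/2) * (f x ^ 2 * sin x) - f' x ^ 2 * sin x)
    (continuousOn_const.mul ((continuousOn_const.mul (hfc.mul hUc)).sub ((hUc.pow 2).mul hhc)))
    (fun x hx => by
      have hx' := Ioo_subset_Icc_self hx
      exact (((((hderiv x hx').mul (hUd x hx)).const_mul 2).sub
        (((hUd x hx).pow 2).mul (hhd x hx'))).const_mul (ν^2 + 1/2)).hasDerivWithinAt)
    (by
      have := (hf2.const_mul (ν^2 + 1/2)).sub hf'2
      rw [intervalIntegrable_iff_integrableOn_Icc_of_le hab] at this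
      exact this)
    (fun x hx => by
      have hx' := Ioo_subset_Icc_self hx
      have := picone_alg ν (sin x) (cos x) (tan (ν * (x - π/2))) (U x) (f x) (f' x)
        (hspos x hx') (sin_sq_add_cos_sq x)
      refine this.trans (le_of_eq ?_)
      simp [hh])
  rw [intervalIntegral.integral_sub (hf2.const_mul _) hf'2,
    intervalIntegral.integral_const_mul] at main
  simp only [hUa, hUb] at main
  linarith

/-- Weighted Poincaré inequality with weight `sin φ` on `(π/2-α, π/2+α)` for functions of
vanishing weighted mean, with constant `C_{α,A} = 4α²/(π² + 2α²)`; and `C_{π/6,A} = 2/19`. -/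
theorem weighted_poincare_mean_zero (α : ℝ) (hα : 0 < α) (hα' : α < π/2)
    (f f' : ℝ → ℝ)
    (hderiv : ∀ x ∈ Set.Icc (π/2 - α) (π/2 + α), HasDerivAt f (f' x) x)
    (hf2 : IntervalIntegrable (fun x => f x ^ 2 * Real.sin x) volume (π/2 - α) (π/2 + α))
    (hf'2 : IntervalIntegrable (fun x => f' x ^ 2 * Real.sin x) volume (π/2 - α) (π/2 + α))
    (hmean : (∫ x in (π/2 - α)..(π/2 + α), f x * Real.sin x) = 0) :
    (∫ x in (π/2 - α)..(π/2 + α), f x ^ 2 * Real.sin x)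
      ≤ (4 * α^2 / (π^2 + 2 * α^2)) * ∫ x in (π/2 - α)..(π/2 + α), f' x ^ 2 * Real.sin x
    ∧ 4 * (π/6)^2 / (π^2 + 2 * (π/6)^2) = 2/19 := by
  constructor
  · have hlim : Filter.Tendsto (fun ν : ℝ =>
        (ν^2 + 1/2) * (∫ x in (π/2 - α)..(π/2 + α), f x ^ 2 * Real.sin x))
        (nhdsWithin (π / (2 * α)) (Iio (π / (2 * α))))
        (nhds (((π / (2 * α))^2 + 1/2) *
          (∫ x in (π/2 - α)..(π/2 + α), f x ^ 2 * Real.sin x))) := by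
      apply Filter.Tendsto.mono_left _ nhdsWithin_le_nhds
      exact Continuous.tendsto (by fun_prop) _
    have hpos : 0 < π / (2 * α) := by positivity
    have key := le_of_tendsto hlim (by
      filter_upwards [Ioo_mem_nhdsLT hpos] with ν hν
      refine poincare_sub α hα hα' f f' hderiv hf2 hf'2 hmean ν hν.1 ?_
      have := hν.2
      rw [lt_div_iff₀ (by positivity)] at this
      linarith)
    have e : (π / (2 * α))^2 + 1/2 = (π^2 + 2 * α^2) / (4 * α^2) := by
      field_simp
      ring
    rw [e, div_mul_eq_mul_div, div_le_iff₀ (by positivity)] at key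
    rw [div_mul_eq_mul_div, le_div_iff₀ (by positivity)]
    linarith
  · have := pi_pos.ne'
    field_simp
    norm_num
end

section
/- Let m ≥ 1000 and 0 < α ≤ π/6, and let D_m = {(ρ,φ): 1/m < ρ < 1, π/2-α < φ < π/2+α} (in spherical coordinates, axisymmetric). For every axisymmetric f ∈ H¹(D_m) with ∫_{D_m} f dx = 0, one has ∫_{D_m} f² dx ≤ (1/11)∫_{D_m}|∂_ρ f|² dx + (2/19)∫_{D_m}|ρ⁻¹∂_φ f|² dx ≤ (2/19)∫_{D_m}|∇f|² dx. -/
open MeasureTheory Real Set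

/-- Weighted one-dimensional Poincaré inequality from a Riccati supersolution. -/
lemma wp_aux (a b lam : ℝ) (hab : a < b) (hlam : 0 ≤ lam) (u u' p p' θ θ' : ℝ → ℝ)
    (hu : ContinuousOn u (Icc a b)) (hu' : ContinuousOn u' (Icc a b))
    (hp : ContinuousOn p (Icc a b)) (hp' : ContinuousOn p' (Icc a b))
    (hθ : ContinuousOn θ (Icc a b)) (hθ' : ContinuousOn θ' (Icc a b))
    (du : ∀ x ∈ Ioo a b, HasDerivAt u (u' x) x)
    (dp : ∀ x ∈ Ioo a b, HasDerivAt p (p' x) x)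
    (dθ : ∀ x ∈ Ioo a b, HasDerivAt θ (θ' x) x)
    (ppos : ∀ x ∈ Icc a b, 0 < p x)
    (hric : ∀ x ∈ Icc a b, lam ≤ -θ' x + θ x * (p' x / p x) - θ x ^ 2)
    (hmean : ∫ x in a..b, u x * p x = 0) :
    lam * ∫ x in a..b, u x ^ 2 * p x ≤ ∫ x in a..b, u' x ^ 2 * p x := by
  have hle := hab.le
  have pne : ∀ x ∈ Icc a b, p x ≠ 0 := fun x hx => (ppos x hx).ne'
  have hup : ContinuousOn (fun x => u x * p x) (Icc a b) := hu.mul hp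
  have hupi : IntervalIntegrable (fun x => u x * p x) volume a b :=
    hup.intervalIntegrable_of_Icc hle
  set g : ℝ → ℝ := fun x => ∫ t in a..x, u t * p t with hg
  have ga : g a = 0 := by simp [hg]
  have gb : g b = 0 := hmean
  have gc : ContinuousOn g (Icc a b) := by
    have := intervalIntegral.continuousOn_primitive_interval (μ := volume)
      (f := fun x => u x * p x) (a := a) (b := b) (by
        rw [uIcc_of_le hle]; exact hup.integrableOn_Icc)
    rwa [uIcc_of_le hle] at this
  have dg : ∀ x ∈ Ioo a b, HasDerivAt g (u x * p x) x := by
    intro x hx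
    have hnx : Icc a b ∈ nhds x := Icc_mem_nhds hx.1 hx.2
    apply intervalIntegral.integral_hasDerivAt_right
    · exact (hup.mono (Icc_subset_Icc le_rfl hx.2.le)).intervalIntegrable_of_Icc hx.1.le
    · exact (hup.mono Ioo_subset_Icc_self).stronglyMeasurableAtFilter isOpen_Ioo x hx
    · exact hup.continuousAt hnx
  set F' : ℝ → ℝ := fun x => 2 * lam * (u' x * g x + u x * (u x * p x))
    - lam * ((2 * g x * (u x * p x)) * (θ x / p x)
      + g x ^ 2 * ((θ' x * p x - θ x * p' x) / p x ^ 2)) with hF'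
  have F'c : ContinuousOn F' (Icc a b) := by
    have p2 : ∀ x ∈ Icc a b, p x ^ 2 ≠ 0 := fun x hx => pow_ne_zero 2 (pne x hx)
    have h1 := hθ.div hp pne
    have h2 := ((hθ'.mul hp).sub (hθ.mul hp')).div (hp.pow 2) p2
    exact (((hu'.mul gc).add (hu.mul hup)).const_mul (2*lam) |>.congr (by
        intro x hx; simp)).sub
      (((((gc.const_mul 2).mul hup).mul h1).add ((gc.pow 2).mul h2)).const_mul lam)
  have key : ∫ x in a..b, F' x = 0 := by
    have := intervalIntegral.integral_eq_sub_of_hasDerivAt_of_le hle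
      (f := fun x => 2 * lam * (u x * g x) - lam * (g x ^ 2 * (θ x / p x))) (f' := F')
      (((hu.mul gc).const_mul (2*lam)).sub
        (((gc.pow 2).mul (hθ.div hp pne)).const_mul lam)) (by
        intro x hx
        have hx' := Ioo_subset_Icc_self hx
        have e1 := ((du x hx).mul (dg x hx)).const_mul (2*lam)
        have e2 := (((dg x hx).pow 2).mul ((dθ x hx).div (dp x hx) (pne x hx'))).const_mul lam
        refine (e1.sub e2).congr_deriv ?_
        simp [hF'])
      (F'c.intervalIntegrable_of_Icc hle)
    rw [this]; simp [ga, gb]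
  have I1 : IntervalIntegrable (fun x => u' x ^ 2 * p x) volume a b :=
    ((hu'.pow 2).mul hp).intervalIntegrable_of_Icc hle
  have I2 : IntervalIntegrable (fun x => u x ^ 2 * p x) volume a b :=
    ((hu.pow 2).mul hp).intervalIntegrable_of_Icc hle
  have I3 : IntervalIntegrable F' volume a b := F'c.intervalIntegrable_of_Icc hle
  have pos : 0 ≤ ∫ x in a..b, (u' x ^ 2 * p x - lam * (u x ^ 2 * p x) + F' x) := by
    apply intervalIntegral.integral_nonneg hle
    intro x hx
    have hpx := ppos x hx
    have hr := hric x hx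
    have hpn := hpx.ne'
    have e : u' x ^ 2 * p x - lam * (u x ^ 2 * p x) + F' x
        = p x * (u' x + lam * (g x / p x)) ^ 2 + lam * (p x * (u x - (g x / p x) * θ x) ^ 2)
        + lam * (p x * (g x / p x) ^ 2) * (-θ' x + θ x * (p' x / p x) - θ x ^ 2 - lam) := by
      simp only [hF']
      field_simp
      ring
    rw [e]
    have : 0 ≤ -θ' x + θ x * (p' x / p x) - θ x ^ 2 - lam := by linarith
    positivity
  rw [intervalIntegral.integral_add (I1.sub (I2.const_mul lam)) I3,
    intervalIntegral.integral_sub I1 (I2.const_mul lam), key,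
    intervalIntegral.integral_const_mul] at pos
  linarith

lemma one_div_cos_sq' (y : ℝ) (h : cos y ≠ 0) : 1 / cos y ^ 2 = 1 + tan y ^ 2 := by
  rw [tan_eq_sin_div_cos]
  have := sin_sq_add_cos_sq y
  field_simp
  linarith

lemma wp_rad (a : ℝ) (h0 : 0 < a) (h1 : a < 1) (u u' : ℝ → ℝ)
    (hu : ContinuousOn u (Icc a 1)) (hu' : ContinuousOn u' (Icc a 1))
    (du : ∀ x ∈ Ioo a 1, HasDerivAt u (u' x) x)
    (hmean : ∫ x in a..1, u x * x ^ 2 = 0) :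
    11 * ∫ x in a..1, u x ^ 2 * x ^ 2 ≤ ∫ x in a..1, u' x ^ 2 * x ^ 2 := by
  have xne : ∀ x ∈ Icc a 1, x ≠ 0 := fun x hx => (h0.trans_le hx.1).ne'
  have cpos : ∀ x ∈ Icc a 1, 0 < cos (3 * (x - (1+a)/2)) := by
    intro x hx
    have := Real.pi_gt_three
    apply cos_pos_of_mem_Ioo
    constructor <;> nlinarith [hx.1, hx.2]
  have D : ∀ x ∈ Icc a 1, HasDerivAt (fun x => x⁻¹ - 3 * tan (3 * (x - (1+a)/2)))
      (-(1/x^2) - 9 / cos (3 * (x - (1+a)/2))^2) x := by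
    intro x hx
    have e1 := (hasDerivAt_inv (xne x hx))
    have e2 := (((hasDerivAt_id x).sub_const ((1+a)/2)).const_mul 3)
    have e3 := ((Real.hasDerivAt_tan (cpos x hx).ne').comp x e2).const_mul 3
    refine (e1.sub e3).congr_deriv ?_
    rw [mul_one, one_div]; ring
  apply wp_aux a 1 11 h1 (by norm_num) u u' (fun x => x^2) (fun x => 2*x)
    (fun x => x⁻¹ - 3 * tan (3 * (x - (1+a)/2)))
    (fun x => -(1/x^2) - 9 / cos (3 * (x - (1+a)/2))^2) hu hu' (by fun_prop) (by fun_prop)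
    (fun x hx => (D x hx).continuousAt.continuousWithinAt) _ du _
    (fun x hx => D x (Ioo_subset_Icc_self hx)) _ _ hmean
  · apply ContinuousOn.sub
    · exact (continuousOn_const.div (by fun_prop) (fun x hx => pow_ne_zero 2 (xne x hx))).neg
    · exact (continuousOn_const.div (by fun_prop) (fun x hx => pow_ne_zero 2 (cpos x hx).ne'))
  · intro x hx; simpa using hasDerivAt_pow 2 x
  · intro x hx; have := h0.trans_le hx.1; positivity
  · intro x hx
    have hx0 := h0.trans_le hx.1
    have hc := cpos x hx
    have e : (9:ℝ) / cos (3 * (x - (1+a)/2))^2 = 9 + 9 * tan (3 * (x - (1+a)/2))^2 := by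
      rw [div_eq_mul_one_div, one_div_cos_sq' _ hc.ne']; ring
    have hx2 : 1 ≤ 1 / x^2 := by
      rw [le_div_iff₀ (by positivity)]; nlinarith [hx.2]
    rw [e]
    generalize tan (3 * (x - (1+a)/2)) = T
    have : -(-(1 / x ^ 2) - (9 + 9 * T ^ 2)) + (x⁻¹ - 3 * T) * (2 * x / x ^ 2)
      - (x⁻¹ - 3 * T) ^ 2 = 2 * (1/x^2) + 9 := by field_simp; ring
    rw [this]; linarith

lemma wp_ang_k (α k : ℝ) (hα : 0 < α) (hα' : α ≤ π/6) (hk0 : 0 < k) (hk : k < 3) (u u' : ℝ → ℝ)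
    (hu : ContinuousOn u (Icc (π/2-α) (π/2+α))) (hu' : ContinuousOn u' (Icc (π/2-α) (π/2+α)))
    (du : ∀ x ∈ Ioo (π/2-α) (π/2+α), HasDerivAt u (u' x) x)
    (hmean : ∫ x in (π/2-α)..(π/2+α), u x * sin x = 0) :
    (k^2 + 1/2) * ∫ x in (π/2-α)..(π/2+α), u x ^ 2 * sin x
      ≤ ∫ x in (π/2-α)..(π/2+α), u' x ^ 2 * sin x := by
  have hpi := Real.pi_pos
  have spos : ∀ x ∈ Icc (π/2-α) (π/2+α), 0 < sin x := by
    intro x hx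
    apply sin_pos_of_pos_of_lt_pi <;> linarith [hx.1, hx.2]
  have cpos : ∀ x ∈ Icc (π/2-α) (π/2+α), 0 < cos (k * (x - π/2)) := by
    intro x hx
    apply cos_pos_of_mem_Ioo
    constructor <;> nlinarith [hx.1, hx.2]
  have D : ∀ x ∈ Icc (π/2-α) (π/2+α),
      HasDerivAt (fun x => (1/2) * (cos x / sin x) - k * tan (k * (x - π/2)))
      (-(1/2) * (1 / sin x^2) - k^2 / cos (k * (x - π/2))^2) x := by
    intro x hx
    have hs := spos x hx
    have e1 := ((hasDerivAt_cos x).div (hasDerivAt_sin x) hs.ne').const_mul (1/2)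
    have e2 := (((hasDerivAt_id x).sub_const (π/2)).const_mul k)
    have e3 := ((Real.hasDerivAt_tan (cpos x hx).ne').comp x e2).const_mul k
    refine (e1.sub e3).congr_deriv ?_
    have h1 : -sin x * sin x - cos x * cos x = -1 := by nlinarith [sin_sq_add_cos_sq x]
    rw [h1]
    ring
  apply wp_aux _ _ (k^2+1/2) (by linarith) (by positivity) u u' sin cos
    (fun x => (1/2) * (cos x / sin x) - k * tan (k * (x - π/2)))
    (fun x => -(1/2) * (1 / sin x^2) - k^2 / cos (k * (x - π/2))^2) hu hu'
    (by fun_prop) (by fun_prop)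
    (fun x hx => (D x hx).continuousAt.continuousWithinAt) _ du (fun x _ => hasDerivAt_sin x)
    (fun x hx => D x (Ioo_subset_Icc_self hx)) spos _ hmean
  · apply ContinuousOn.sub
    · exact (continuousOn_const.div (by fun_prop)
        (fun x hx => pow_ne_zero 2 (spos x hx).ne')).const_mul _
    · exact (continuousOn_const.div (by fun_prop) (fun x hx => pow_ne_zero 2 (cpos x hx).ne'))
  · intro x hx
    have hs := spos x hx
    have hc := cpos x hx
    have e : k^2 / cos (k * (x - π/2))^2 = k^2 + k^2 * tan (k * (x - π/2))^2 := by
      rw [div_eq_mul_one_div, one_div_cos_sq' _ hc.ne']; ring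
    have e2 : 1 / sin x ^ 2 = 1 + (cos x / sin x)^2 := by
      have := sin_sq_add_cos_sq x
      field_simp
      linarith
    rw [e, e2]
    generalize tan (k * (x - π/2)) = T
    generalize cos x / sin x = C
    nlinarith [sq_nonneg C]

lemma wp_ang (α : ℝ) (hα : 0 < α) (hα' : α ≤ π/6) (u u' : ℝ → ℝ)
    (hu : ContinuousOn u (Icc (π/2-α) (π/2+α))) (hu' : ContinuousOn u' (Icc (π/2-α) (π/2+α)))
    (du : ∀ x ∈ Ioo (π/2-α) (π/2+α), HasDerivAt u (u' x) x)
    (hmean : ∫ x in (π/2-α)..(π/2+α), u x * sin x = 0) :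
    (19/2) * ∫ x in (π/2-α)..(π/2+α), u x ^ 2 * sin x
      ≤ ∫ x in (π/2-α)..(π/2+α), u' x ^ 2 * sin x := by
  set A := ∫ x in (π/2-α)..(π/2+α), u x ^ 2 * sin x
  have ht : Filter.Tendsto (fun k : ℝ => (k^2+1/2) * A) (nhdsWithin 3 (Iio 3))
      (nhds ((3^2+1/2) * A)) := by
    have : Continuous (fun k : ℝ => (k^2+1/2) * A) := by fun_prop
    exact (this.tendsto 3).mono_left nhdsWithin_le_nhds
  have := le_of_tendsto ht (b := ∫ x in (π/2-α)..(π/2+α), u' x ^ 2 * sin x) (by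
    filter_upwards [Ioo_mem_nhdsLT (show (0:ℝ) < 3 by norm_num)] with k hk
    exact wp_ang_k α k hα hα' hk.1 hk.2 u u' hu hu' du hmean)
  norm_num at this ⊢
  linarith

lemma cont_param (a b c d : ℝ) (hab : a ≤ b) (hcd : c ≤ d) (G : ℝ → ℝ → ℝ)
    (hG : ContinuousOn (fun p : ℝ × ℝ => G p.1 p.2) (Icc a b ×ˢ Icc c d)) :
    ContinuousOn (fun x => ∫ t in c..d, G x t) (Icc a b) := by
  have h1 : Continuous (fun q : ℝ × ℝ => G (projIcc a b hab q.1) (projIcc c d hcd q.2)) := by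
    refine hG.comp_continuous (f := fun q : ℝ × ℝ =>
      ((projIcc a b hab q.1 : ℝ), (projIcc c d hcd q.2 : ℝ))) ?_ ?_
    · have := continuous_projIcc (h := hab)
      have := continuous_projIcc (h := hcd)
      fun_prop
    · intro q; exact ⟨(projIcc a b hab q.1).2, (projIcc c d hcd q.2).2⟩
  have h2 := intervalIntegral.continuous_parametric_intervalIntegral_of_continuous'
    (μ := volume) (f := fun x t => G (projIcc a b hab x) (projIcc c d hcd t)) h1 c d
  refine h2.continuousOn.congr ?_
  intro x hx
  apply intervalIntegral.integral_congr
  intro t ht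
  rw [uIcc_of_le hcd] at ht
  simp [projIcc_of_mem hab hx, projIcc_of_mem hcd ht]

lemma cont_slice (a b c d : ℝ) (G : ℝ → ℝ → ℝ)
    (hG : ContinuousOn (fun p : ℝ × ℝ => G p.1 p.2) (Icc a b ×ˢ Icc c d))
    (x : ℝ) (hx : x ∈ Icc a b) : ContinuousOn (fun t => G x t) (Icc c d) :=
  hG.comp (f := fun t => (x, t)) (by fun_prop) (fun t ht => ⟨hx, ht⟩)

lemma deriv_param (a b c d : ℝ) (hcd : c ≤ d) (G G' : ℝ → ℝ → ℝ)
    (hG : ContinuousOn (fun p : ℝ × ℝ => G p.1 p.2) (Icc a b ×ˢ Icc c d))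
    (hG' : ContinuousOn (fun p : ℝ × ℝ => G' p.1 p.2) (Icc a b ×ˢ Icc c d))
    (hd : ∀ x ∈ Icc a b, ∀ t ∈ Icc c d, HasDerivAt (fun s => G s t) (G' x t) x)
    (x : ℝ) (hx : x ∈ Ioo a b) :
    HasDerivAt (fun x => ∫ t in c..d, G x t) (∫ t in c..d, G' x t) x := by
  obtain ⟨C, hC⟩ := (isCompact_Icc.prod isCompact_Icc).exists_bound_of_continuousOn hG'
  have hsub : uIoc c d ⊆ Icc c d := by rw [uIoc_of_le hcd]; exact Ioc_subset_Icc_self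
  have hmem : Icc a b ∈ nhds x := Icc_mem_nhds hx.1 hx.2
  have meas : ∀ H : ℝ → ℝ → ℝ, ContinuousOn (fun p : ℝ × ℝ => H p.1 p.2) (Icc a b ×ˢ Icc c d) →
      ∀ y ∈ Icc a b, IntervalIntegrable (fun t => H y t) volume c d := fun H hH y hy =>
    (cont_slice a b c d H hH y hy).intervalIntegrable_of_Icc hcd
  refine (intervalIntegral.hasDerivAt_integral_of_dominated_loc_of_deriv_le
    (bound := fun _ => C) (F := G) (F' := G') (s := Icc a b) hmem ?_ ?_ ?_ ?_ ?_ ?_).2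
  · filter_upwards [hmem] with y hy
    exact (meas G hG y hy).def'.aestronglyMeasurable
  · exact meas G hG x (Ioo_subset_Icc_self hx)
  · exact (meas G' hG' x (Ioo_subset_Icc_self hx)).def'.aestronglyMeasurable
  · filter_upwards with t ht y hy
    exact hC (y, t) ⟨hy, hsub ht⟩
  · simp
  · filter_upwards with t ht y hy
    exact hd y hy t (hsub ht)

/-- Poincaré inequality on the truncated conical shell
`D_m = {1/m < ρ < 1, π/2-α < φ < π/2+α}` (spherical coordinates, axisymmetric functions,
`dx = 2πρ² sin φ dρ dφ`) for functions with vanishing mean: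
`∫ f² dx ≤ (1/11)∫|∂_ρ f|² dx + (2/19)∫|ρ⁻¹∂_φ f|² dx ≤ (2/19)∫|∇f|² dx`. -/
theorem poincare_Dm_mean_zero (m : ℕ) (hm : 1000 ≤ m) (α : ℝ) (hα : 0 < α) (hα' : α ≤ π/6)
    (f fr fp : ℝ → ℝ → ℝ)
    (hcf : ContinuousOn (fun p : ℝ × ℝ => f p.1 p.2)
      (Set.Icc (1/(m:ℝ)) 1 ×ˢ Set.Icc (π/2 - α) (π/2 + α)))
    (hcr : ContinuousOn (fun p : ℝ × ℝ => fr p.1 p.2)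
      (Set.Icc (1/(m:ℝ)) 1 ×ˢ Set.Icc (π/2 - α) (π/2 + α)))
    (hcp : ContinuousOn (fun p : ℝ × ℝ => fp p.1 p.2)
      (Set.Icc (1/(m:ℝ)) 1 ×ˢ Set.Icc (π/2 - α) (π/2 + α)))
    (hdr : ∀ ρ ∈ Set.Icc (1/(m:ℝ)) 1, ∀ φ ∈ Set.Icc (π/2 - α) (π/2 + α),
      HasDerivAt (fun s => f s φ) (fr ρ φ) ρ)
    (hdp : ∀ ρ ∈ Set.Icc (1/(m:ℝ)) 1, ∀ φ ∈ Set.Icc (π/2 - α) (π/2 + α),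
      HasDerivAt (fun t => f ρ t) (fp ρ φ) φ)
    (hmean : (∫ ρ in (1/(m:ℝ))..1, ∫ φ in (π/2 - α)..(π/2 + α),
        f ρ φ * (2*π*ρ^2*Real.sin φ)) = 0) :
    (∫ ρ in (1/(m:ℝ))..1, ∫ φ in (π/2 - α)..(π/2 + α),
        f ρ φ ^ 2 * (2*π*ρ^2*Real.sin φ))
      ≤ (1/11) * (∫ ρ in (1/(m:ℝ))..1, ∫ φ in (π/2 - α)..(π/2 + α),
            fr ρ φ ^ 2 * (2*π*ρ^2*Real.sin φ))
        + (2/19) * (∫ ρ in (1/(m:ℝ))..1, ∫ φ in (π/2 - α)..(π/2 + α),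
            (fp ρ φ / ρ) ^ 2 * (2*π*ρ^2*Real.sin φ))
    ∧ (1/11) * (∫ ρ in (1/(m:ℝ))..1, ∫ φ in (π/2 - α)..(π/2 + α),
            fr ρ φ ^ 2 * (2*π*ρ^2*Real.sin φ))
        + (2/19) * (∫ ρ in (1/(m:ℝ))..1, ∫ φ in (π/2 - α)..(π/2 + α),
            (fp ρ φ / ρ) ^ 2 * (2*π*ρ^2*Real.sin φ))
      ≤ (2/19) * (∫ ρ in (1/(m:ℝ))..1, ∫ φ in (π/2 - α)..(π/2 + α),
            (fr ρ φ ^ 2 + (fp ρ φ / ρ) ^ 2) * (2*π*ρ^2*Real.sin φ)) := by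
  have hm0 : (0:ℝ) < m := by have : (1000:ℝ) ≤ m := by exact_mod_cast hm
                             linarith
  have ha0 : 0 < 1/(m:ℝ) := by positivity
  have ha1 : 1/(m:ℝ) < 1 := by
    rw [div_lt_one hm0]; have : (1000:ℝ) ≤ m := by exact_mod_cast hm
    linarith
  have hpi := Real.pi_pos
  generalize 1/(m:ℝ) = a at *
  have hc : π/2 - α < π/2 + α := by linarith
  have spos : ∀ x ∈ Icc (π/2-α) (π/2+α), 0 < sin x := by
    intro x hx
    apply sin_pos_of_pos_of_lt_pi <;> linarith [hx.1, hx.2]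
  have hang := wp_ang α hα hα'
  generalize π/2 - α = c at *
  generalize π/2 + α = d at *
  have hcs : ContinuousOn (fun p : ℝ × ℝ => sin p.2) (Icc a 1 ×ˢ Icc c d) := by fun_prop
  -- the angular integrals
  set A : ℝ → ℝ := fun ρ => ∫ φ in c..d, f ρ φ ^ 2 * sin φ with hA
  set B : ℝ → ℝ := fun ρ => ∫ φ in c..d, f ρ φ * sin φ with hB
  set R : ℝ → ℝ := fun ρ => ∫ φ in c..d, fr ρ φ ^ 2 * sin φ with hR
  set R1 : ℝ → ℝ := fun ρ => ∫ φ in c..d, fr ρ φ * sin φ with hR1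
  set P : ℝ → ℝ := fun ρ => ∫ φ in c..d, fp ρ φ ^ 2 * sin φ with hP
  set S : ℝ := ∫ φ in c..d, sin φ with hS
  have Spos : 0 < S := by
    apply intervalIntegral.intervalIntegral_pos_of_pos_on
      (continuous_sin.intervalIntegrable _ _) _ hc
    intro x hx; exact spos x (Ioo_subset_Icc_self hx)
  have cA : ContinuousOn A (Icc a 1) := cont_param a 1 c d ha1.le hc.le
    (fun ρ φ => f ρ φ ^ 2 * sin φ) ((hcf.pow 2).mul hcs)
  have cB : ContinuousOn B (Icc a 1) := cont_param a 1 c d ha1.le hc.le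
    (fun ρ φ => f ρ φ * sin φ) (hcf.mul hcs)
  have cR : ContinuousOn R (Icc a 1) := cont_param a 1 c d ha1.le hc.le
    (fun ρ φ => fr ρ φ ^ 2 * sin φ) ((hcr.pow 2).mul hcs)
  have cR1 : ContinuousOn R1 (Icc a 1) := cont_param a 1 c d ha1.le hc.le
    (fun ρ φ => fr ρ φ * sin φ) (hcr.mul hcs)
  have cP : ContinuousOn P (Icc a 1) := cont_param a 1 c d ha1.le hc.le
    (fun ρ φ => fp ρ φ ^ 2 * sin φ) ((hcp.pow 2).mul hcs)
  have dB : ∀ x ∈ Ioo a 1, HasDerivAt B (R1 x) x := fun x hx =>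
    deriv_param a 1 c d hc.le (fun ρ φ => f ρ φ * sin φ) (fun ρ φ => fr ρ φ * sin φ)
      (hcf.mul hcs) (hcr.mul hcs) (fun y hy t ht => (hdr y hy t ht).mul_const _) x hx
  -- variance identity on slices
  have var : ∀ v : ℝ → ℝ, ContinuousOn v (Icc c d) → ∀ k : ℝ,
      (∫ φ in c..d, (v φ - k) ^ 2 * sin φ) = (∫ φ in c..d, v φ ^ 2 * sin φ)
        - 2 * k * (∫ φ in c..d, v φ * sin φ) + k ^ 2 * S := by
    intro v hv k
    have i1 : IntervalIntegrable (fun φ => v φ ^ 2 * sin φ) volume c d :=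
      ((hv.pow 2).mul continuousOn_sin).intervalIntegrable_of_Icc hc.le
    have i2 : IntervalIntegrable (fun φ => v φ * sin φ) volume c d :=
      (hv.mul continuousOn_sin).intervalIntegrable_of_Icc hc.le
    have i3 : IntervalIntegrable sin volume c d := continuous_sin.intervalIntegrable _ _
    rw [hS, ← intervalIntegral.integral_const_mul, ← intervalIntegral.integral_const_mul,
      ← intervalIntegral.integral_sub i1 (i2.const_mul _),
      ← intervalIntegral.integral_add (i1.sub (i2.const_mul _)) (i3.const_mul _)]
    apply intervalIntegral.integral_congr
    intro x _
    ring
  have hvA : ∀ ρ ∈ Icc a 1, A ρ ≤ (2/19) * P ρ + B ρ ^ 2 / S := by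
    intro ρ hρ
    have cv := cont_slice a 1 c d f hcf ρ hρ
    have hk := hang (fun φ => f ρ φ - B ρ / S) (fun φ => fp ρ φ) (cv.sub continuousOn_const)
      (cont_slice a 1 c d fp hcp ρ hρ)
      (fun x hx => (hdp ρ hρ x (Ioo_subset_Icc_self hx)).sub_const _) (by
        simp only [sub_mul]
        have i1 : IntervalIntegrable (fun φ => f ρ φ * sin φ) volume c d :=
          (cv.mul continuousOn_sin).intervalIntegrable_of_Icc hc.le
        rw [intervalIntegral.integral_sub i1
          ((continuous_sin.intervalIntegrable _ _).const_mul _),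
          intervalIntegral.integral_const_mul]
        change B ρ - B ρ / S * S = 0
        field_simp
        ring)
    rw [var _ cv] at hk
    change 19/2 * (A ρ - 2 * (B ρ / S) * B ρ + (B ρ / S)^2 * S) ≤ P ρ at hk
    have e : A ρ - 2 * (B ρ / S) * B ρ + (B ρ / S)^2 * S = A ρ - B ρ ^ 2 / S := by
      field_simp; ring
    rw [e] at hk
    linarith
  have hvR : ∀ ρ ∈ Icc a 1, R1 ρ ^ 2 / S ≤ R ρ := by
    intro ρ hρ
    have cv := cont_slice a 1 c d fr hcr ρ hρ
    have h0 : 0 ≤ ∫ φ in c..d, (fr ρ φ - R1 ρ / S) ^ 2 * sin φ := by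
      apply intervalIntegral.integral_nonneg hc.le
      intro x hx
      have := spos x hx
      positivity
    rw [var _ cv] at h0
    change 0 ≤ R ρ - 2 * (R1 ρ / S) * R1 ρ + (R1 ρ / S)^2 * S at h0
    have e : R ρ - 2 * (R1 ρ / S) * R1 ρ + (R1 ρ / S)^2 * S = R ρ - R1 ρ ^ 2 / S := by
      field_simp; ring
    rw [e] at h0
    linarith
  have hPn : ∀ ρ, 0 ≤ P ρ := by
    intro ρ
    apply intervalIntegral.integral_nonneg hc.le
    intro x hx
    have := spos x hx
    positivity
  have hRn : ∀ ρ, 0 ≤ R ρ := by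
    intro ρ
    apply intervalIntegral.integral_nonneg hc.le
    intro x hx
    have := spos x hx
    positivity
  -- rewrite the iterated integrals
  have pull : ∀ (v : ℝ → ℝ) (ρ : ℝ), (∫ φ in c..d, v φ * (2*π*ρ^2*sin φ))
      = (2*π) * (ρ^2 * ∫ φ in c..d, v φ * sin φ) := by
    intro v ρ
    rw [← intervalIntegral.integral_const_mul, ← intervalIntegral.integral_const_mul]
    apply intervalIntegral.integral_congr
    intro x _
    ring
  have E0 : (∫ ρ in a..1, ∫ φ in c..d, f ρ φ * (2*π*ρ^2*sin φ))
      = (2*π) * ∫ ρ in a..1, B ρ * ρ^2 := by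
    rw [← intervalIntegral.integral_const_mul]
    apply intervalIntegral.integral_congr
    intro ρ _
    simp only [pull]
    rw [mul_comm (ρ^2)]
  have E1 : (∫ ρ in a..1, ∫ φ in c..d, f ρ φ ^ 2 * (2*π*ρ^2*sin φ))
      = (2*π) * ∫ ρ in a..1, ρ^2 * A ρ := by
    rw [← intervalIntegral.integral_const_mul]
    apply intervalIntegral.integral_congr
    intro ρ _
    exact pull (fun φ => f ρ φ ^ 2) ρ
  have E2 : (∫ ρ in a..1, ∫ φ in c..d, fr ρ φ ^ 2 * (2*π*ρ^2*sin φ))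
      = (2*π) * ∫ ρ in a..1, ρ^2 * R ρ := by
    rw [← intervalIntegral.integral_const_mul]
    apply intervalIntegral.integral_congr
    intro ρ _
    exact pull (fun φ => fr ρ φ ^ 2) ρ
  have divP : ∀ ρ ∈ Icc a 1, ρ^2 * (∫ φ in c..d, (fp ρ φ / ρ) ^ 2 * sin φ) = P ρ := by
    intro ρ hρ
    have : ρ ≠ 0 := (ha0.trans_le hρ.1).ne'
    rw [← intervalIntegral.integral_const_mul]
    apply intervalIntegral.integral_congr
    intro x _
    simp only
    field_simp
  have E3 : (∫ ρ in a..1, ∫ φ in c..d, (fp ρ φ / ρ) ^ 2 * (2*π*ρ^2*sin φ))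
      = (2*π) * ∫ ρ in a..1, P ρ := by
    rw [← intervalIntegral.integral_const_mul]
    apply intervalIntegral.integral_congr
    intro ρ hρ
    rw [uIcc_of_le ha1.le] at hρ
    simp only
    rw [pull (fun φ => (fp ρ φ / ρ) ^ 2) ρ, divP ρ hρ]
  have iA : IntervalIntegrable (fun ρ => ρ^2 * A ρ) volume a 1 :=
    ContinuousOn.intervalIntegrable_of_Icc ha1.le (by fun_prop)
  have iB : IntervalIntegrable (fun ρ => B ρ ^ 2 * ρ^2) volume a 1 :=
    ContinuousOn.intervalIntegrable_of_Icc ha1.le (by fun_prop)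
  have iR : IntervalIntegrable (fun ρ => ρ^2 * R ρ) volume a 1 :=
    ContinuousOn.intervalIntegrable_of_Icc ha1.le (by fun_prop)
  have iR1 : IntervalIntegrable (fun ρ => R1 ρ ^ 2 * ρ^2) volume a 1 :=
    ContinuousOn.intervalIntegrable_of_Icc ha1.le (by fun_prop)
  have iP : IntervalIntegrable P volume a 1 :=
    ContinuousOn.intervalIntegrable_of_Icc ha1.le cP
  have E4 : (∫ ρ in a..1, ∫ φ in c..d, (fr ρ φ ^ 2 + (fp ρ φ / ρ) ^ 2) * (2*π*ρ^2*sin φ))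
      = (2*π) * ((∫ ρ in a..1, ρ^2 * R ρ) + ∫ ρ in a..1, P ρ) := by
    rw [← intervalIntegral.integral_add iR iP, ← intervalIntegral.integral_const_mul]
    apply intervalIntegral.integral_congr
    intro ρ hρ
    rw [uIcc_of_le ha1.le] at hρ
    simp only
    rw [pull (fun φ => fr ρ φ ^ 2 + (fp ρ φ / ρ) ^ 2) ρ, ← divP ρ hρ, hR, ← mul_add,
      ← intervalIntegral.integral_add]
    · simp only [add_mul]
    · exact (((cont_slice a 1 c d fr hcr ρ hρ).pow 2).mul
        continuousOn_sin).intervalIntegrable_of_Icc hc.le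
    · exact ((((cont_slice a 1 c d fp hcp ρ hρ).div_const ρ).pow 2).mul
        continuousOn_sin).intervalIntegrable_of_Icc hc.le
  rw [E0] at hmean
  have hmean' : ∫ ρ in a..1, B ρ * ρ^2 = 0 := by
    rcases mul_eq_zero.mp hmean with h | h
    · linarith
    · exact h
  have hrad := wp_rad a ha0 ha1 B R1 cB cR1 dB hmean'
  have M1 : (∫ ρ in a..1, ρ^2 * A ρ)
      ≤ (2/19) * (∫ ρ in a..1, P ρ) + (1/S) * ∫ ρ in a..1, B ρ ^ 2 * ρ^2 := by
    rw [← intervalIntegral.integral_const_mul, ← intervalIntegral.integral_const_mul,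
      ← intervalIntegral.integral_add (iP.const_mul _) (iB.const_mul _)]
    apply intervalIntegral.integral_mono_on ha1.le iA ((iP.const_mul _).add (iB.const_mul _))
    intro ρ hρ
    have h0 := ha0.trans_le hρ.1
    have h1 : ρ^2 ≤ 1 := by nlinarith [hρ.2]
    calc ρ^2 * A ρ ≤ ρ^2 * ((2/19) * P ρ + B ρ ^ 2 / S) := by
          gcongr; exact hvA ρ hρ
      _ = (2/19) * (ρ^2 * P ρ) + 1 / S * (B ρ ^ 2 * ρ^2) := by ring
      _ ≤ (2/19) * P ρ + 1 / S * (B ρ ^ 2 * ρ^2) := by nlinarith [hPn ρ]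
  have M2 : (1/S) * (∫ ρ in a..1, R1 ρ ^ 2 * ρ^2) ≤ ∫ ρ in a..1, ρ^2 * R ρ := by
    rw [← intervalIntegral.integral_const_mul]
    apply intervalIntegral.integral_mono_on ha1.le (iR1.const_mul _) iR
    intro ρ hρ
    calc 1 / S * (R1 ρ ^ 2 * ρ^2) = ρ^2 * (R1 ρ ^ 2 / S) := by ring
      _ ≤ ρ^2 * R ρ := by gcongr; exact hvR ρ hρ
  have M3 : (1/S) * (∫ ρ in a..1, B ρ ^ 2 * ρ^2)
      ≤ (1/11) * ((1/S) * (∫ ρ in a..1, R1 ρ ^ 2 * ρ^2)) := by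
    have : 0 < 1/S := by positivity
    nlinarith
  have M4 : 0 ≤ ∫ ρ in a..1, ρ^2 * R ρ := by
    apply intervalIntegral.integral_nonneg ha1.le
    intro ρ _
    have := hRn ρ
    positivity
  rw [E1, E2, E3, E4]
  constructor
  · nlinarith
  · nlinarith
end

section
/- Let m ≥ 1000, 0 < α ≤ π/6, and let i,j,k be integers with i ≥ -2, k ≥ -1, 0 ≤ j ≤ i+2. For every f ∈ H¹(D_m) satisfying ∫_{D_m} f(ρ,φ) ρⁱ sinᵏφ dx = 0, one has ∫_{D_m} (f/ρ)² ρʲ sinᵏφ dx ≤ (4/(j+1)²)∫_{D_m}|∂_ρ f|² ρʲ sinᵏφ dx + (2/(19+k))∫_{D_m}|ρ⁻¹∂_φ f|² ρʲ sinᵏφ dx. -/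
open MeasureTheory Real Set

lemma ah_primitive {a b : ℝ} (hab : a ≤ b) {u : ℝ → ℝ} (hu : ContinuousOn u (Icc a b)) :
    ContinuousOn (fun x => ∫ t in a..x, u t) (Icc a b) ∧
    ∀ x ∈ Ioo a b, HasDerivAt (fun x => ∫ t in a..x, u t) (u x) x := by
  have hi : IntegrableOn u (Icc a b) := hu.integrableOn_Icc
  refine ⟨?_, fun x hx => ?_⟩
  · have := intervalIntegral.continuousOn_primitive_interval (μ := volume) (f := u) (a := a) (b := b)
      (by rwa [uIcc_of_le hab])
    rwa [uIcc_of_le hab] at this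
  · have hn : Icc a b ∈ nhds x := Icc_mem_nhds hx.1 hx.2
    refine intervalIntegral.integral_hasDerivAt_right ?_ ?_ (hu.continuousAt hn)
    · refine ContinuousOn.intervalIntegrable ?_
      rw [uIcc_of_le hx.1.le]
      exact hu.mono (Icc_subset_Icc_right hx.2.le)
    · exact hu.stronglyMeasurableAtFilter_nhdsWithin measurableSet_Icc x |>.filter_mono (by
        rw [nhdsWithin_eq_nhds.2 hn])

lemma ah_cont {a b c d : ℝ} (hab : a ≤ b) (hcd : c ≤ d) {F : ℝ → ℝ → ℝ}
    (hF : ContinuousOn (fun p : ℝ × ℝ => F p.1 p.2) (Icc a b ×ˢ Icc c d)) :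
    ContinuousOn (fun x => ∫ y in c..d, F x y) (Icc a b) := by
  have hG : Continuous (fun p : ℝ × ℝ => F (projIcc a b hab p.1) (projIcc c d hcd p.2)) := by
    refine hF.comp_continuous (f := fun p : ℝ × ℝ => (((projIcc a b hab p.1 : ℝ)), (projIcc c d hcd p.2 : ℝ))) ?_ ?_
    · have h1 := continuous_projIcc (h := hab)
      have h2 := continuous_projIcc (h := hcd)
      fun_prop
    · intro p
      exact ⟨(projIcc a b hab p.1).2, (projIcc c d hcd p.2).2⟩
  have := intervalIntegral.continuous_parametric_intervalIntegral_of_continuous' (μ := volume)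
    (f := fun x y => F (projIcc a b hab x) (projIcc c d hcd y)) hG c d
  refine this.continuousOn.congr fun x hx => ?_
  refine intervalIntegral.integral_congr fun y hy => ?_
  rw [uIcc_of_le hcd] at hy
  simp [projIcc_of_mem hab hx, projIcc_of_mem hcd hy]

lemma ah_deriv {a b c d : ℝ} (hcd : c ≤ d) {F G : ℝ → ℝ → ℝ}
    (hF : ContinuousOn (fun p : ℝ × ℝ => F p.1 p.2) (Icc a b ×ˢ Icc c d))
    (hG : ContinuousOn (fun p : ℝ × ℝ => G p.1 p.2) (Icc a b ×ˢ Icc c d))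
    (hd : ∀ x ∈ Icc a b, ∀ y ∈ Icc c d, HasDerivAt (fun s => F s y) (G x y) x)
    (x : ℝ) (hx : x ∈ Ioo a b) :
    HasDerivAt (fun x => ∫ y in c..d, F x y) (∫ y in c..d, G x y) x := by
  obtain ⟨C, hC⟩ := (isCompact_Icc.prod isCompact_Icc).exists_bound_of_continuousOn hG
  have sl : ∀ {K : ℝ → ℝ → ℝ}, ContinuousOn (fun p : ℝ × ℝ => K p.1 p.2) (Icc a b ×ˢ Icc c d) →
      ∀ s ∈ Icc a b, IntervalIntegrable (K s) volume c d := by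
    intro K hK s hs
    refine ContinuousOn.intervalIntegrable ?_
    rw [uIcc_of_le hcd]
    exact hK.comp (f := fun y => (s, y)) (by fun_prop) (fun y hy => ⟨hs, hy⟩)
  have hsub : Ioo a b ⊆ Icc a b := Ioo_subset_Icc_self
  refine (intervalIntegral.hasDerivAt_integral_of_dominated_loc_of_deriv_le
    (s := Ioo a b) (bound := fun _ => C) (Ioo_mem_nhds hx.1 hx.2) ?_ (sl hF x (hsub hx)) ?_ ?_ ?_ ?_).2
  · filter_upwards [Ioo_mem_nhds hx.1 hx.2] with s hs
    have := (sl hF s (hsub hs)).aestronglyMeasurable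
    rwa [uIoc_of_le hcd]
  · have := (sl hG x (hsub hx)).aestronglyMeasurable
    rwa [uIoc_of_le hcd]
  · refine Filter.Eventually.of_forall fun y hy s hs => hC (s, y) ⟨hsub hs, ?_⟩
    rw [uIoc_of_le hcd] at hy
    exact Ioc_subset_Icc_self hy
  · exact intervalIntegrable_const
  · refine Filter.Eventually.of_forall fun y hy s hs => hd s (hsub hs) y ?_
    rw [uIoc_of_le hcd] at hy
    exact Ioc_subset_Icc_self hy

lemma ah_radial {ε : ℝ} (h0 : 0 < ε) (h1 : ε ≤ 1) (j d : ℕ) {g g' : ℝ → ℝ}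
    (hg : ContinuousOn g (Icc ε 1)) (hg' : ContinuousOn g' (Icc ε 1))
    (hd : ∀ x ∈ Ioo ε 1, HasDerivAt g (g' x) x)
    (hm : ∫ x in ε..1, g x * x ^ (j + d) = 0) :
    ∫ x in ε..1, g x ^ 2 * x ^ j ≤ 4 / ((j:ℝ) + 1) ^ 2 * ∫ x in ε..1, g' x ^ 2 * x ^ (j + 2) := by
  set p : ℝ := (j:ℝ) + 1 with hp
  have hp0 : 0 < p := by positivity
  set c : ℝ := p / 2 * g 1 with hc
  set N : ℝ := (j:ℝ) + 2 * d + 1 with hN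
  have hN0 : 0 < N := by positivity
  have hpN : p ≤ N := by
    rw [hp, hN]; have : (0:ℝ) ≤ d := by positivity
    linarith
  obtain ⟨Kc, Kd⟩ := ah_primitive h1 (u := fun x => g x * x ^ (j + d)) (by fun_prop)
  set K : ℝ → ℝ := fun x => ∫ t in ε..x, g t * t ^ (j + d) with hK
  have K0 : K ε = 0 := by simp [hK]
  have K1 : K 1 = 0 := hm
  have i1 : IntervalIntegrable (fun x => g x ^ 2 * x ^ j) volume ε 1 := by
    apply ContinuousOn.intervalIntegrable; rw [uIcc_of_le h1]; fun_prop
  have i2 : IntervalIntegrable (fun x => g' x ^ 2 * x ^ (j + 2)) volume ε 1 := by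
    apply ContinuousOn.intervalIntegrable; rw [uIcc_of_le h1]; fun_prop
  have key := intervalIntegral.sub_le_integral_of_hasDeriv_right_of_le (a := ε) (b := 1)
    (g := fun x => 2 * c * (x ^ (j + d + 1) * g x) + 2 * c * (p / 2 - (j + d + 1)) * K x
      - c ^ 2 / N * x ^ (j + 2 * d + 1) - p / 2 * (g x ^ 2 * x ^ (j + 1)))
    (g' := fun x => 2 * c * (((j:ℝ) + d + 1) * x ^ (j + d) * g x + x ^ (j + d + 1) * g' x)
      + 2 * c * (p / 2 - (j + d + 1)) * (g x * x ^ (j + d))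
      - c ^ 2 / N * (N * x ^ (j + 2 * d))
      - p / 2 * (2 * g x * g' x * x ^ (j + 1) + g x ^ 2 * (p * x ^ j)))
    (φ := fun x => g' x ^ 2 * x ^ (j + 2) - p ^ 2 / 4 * (g x ^ 2 * x ^ j)) h1
    (by fun_prop) ?_ ?_ ?_
  · rw [intervalIntegral.integral_sub i2 (i1.const_mul _), intervalIntegral.integral_const_mul] at key
    simp only [K0, K1, one_pow, mul_one, mul_zero, add_zero, one_mul] at key
    set A := ∫ x in ε..1, g x ^ 2 * x ^ j
    set B := ∫ x in ε..1, g' x ^ 2 * x ^ (j + 2)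
    have hnn : p ^ 2 / 4 * A ≤ B := by
      have e1 : c ^ 2 / N ≤ c ^ 2 / p := div_le_div_of_nonneg_left (sq_nonneg _) hp0 hpN
      have e2 : c ^ 2 / p = p / 4 * g 1 ^ 2 := by rw [hc]; field_simp; ring
      have e3 : ε ^ (j + 2 * d + 1) ≤ 1 := pow_le_one₀ h0.le h1
      have e4 : (c ^ 2 / N) * (1 - ε ^ (j + 2 * d + 1)) ≤ p / 4 * g 1 ^ 2 * (1 - ε ^ (j + 2 * d + 1)) := by
        apply mul_le_mul_of_nonneg_right _ (by linarith)
        linarith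
      have e5 : 0 ≤ p / 2 * (ε ^ (j + 1) * (g ε - ε ^ d * g 1) ^ 2) := by positivity
      have e6 : 0 ≤ p / 4 * g 1 ^ 2 * (1 - ε ^ (j + 2 * d + 1)) :=
        mul_nonneg (by positivity) (by linarith)
      have e7 : p / 2 * (ε ^ (j + 1) * (g ε - ε ^ d * g 1) ^ 2) = p / 2 * (ε ^ (j + 1) * g ε ^ 2)
         - 2 * c * ε ^ (j + d + 1) * g ε + p / 2 * (ε ^ (j + 2 * d + 1) * g 1 ^ 2) := by
        rw [hc]; ring
      have e8 : 2 * c * g 1 = p * g 1 ^ 2 := by rw [hc]; ring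
      nlinarith
    calc A = 4 / p ^ 2 * (p ^ 2 / 4 * A) := by field_simp
      _ ≤ _ := by gcongr
  · intro x hx
    have hgx := hd x hx
    apply HasDerivAt.hasDerivWithinAt
    have d1 := ((hasDerivAt_pow (j + d + 1) x).mul hgx).const_mul (2 * c)
    have d2 := (Kd x hx).const_mul (2 * c * (p / 2 - (j + d + 1)))
    have d3 := (hasDerivAt_pow (j + 2 * d + 1) x).const_mul (c ^ 2 / N)
    have d4 := ((hgx.pow 2).mul (hasDerivAt_pow (j + 1) x)).const_mul (p / 2)
    refine (((d1.add d2).sub d3).sub d4).congr_deriv ?_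
    simp only [Nat.add_sub_cancel, hp, hN]
    push_cast
    simp
  · exact ContinuousOn.integrableOn_Icc (by fun_prop)
  · intro x hx
    have hx0 : 0 < x := h0.trans hx.1
    have hs : 0 ≤ x ^ j * (x * g' x + p / 2 * g x - c * x ^ d) ^ 2 := by positivity
    have e : c ^ 2 / N * (N * x ^ (j + 2 * d)) = c ^ 2 * x ^ (j + 2 * d) := by field_simp
    rw [e]
    refine sub_nonneg.1 (hs.trans_eq ?_)
    ring

lemma ah_poincare {a b L : ℝ} (hab : a ≤ b) (hL : 0 ≤ L) {w q r q' h h' : ℝ → ℝ}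
    (hw0 : ∀ x ∈ Icc a b, 0 < w x)
    (hwc : ContinuousOn w (Icc a b)) (hqc : ContinuousOn q (Icc a b))
    (hw : ∀ x ∈ Icc a b, HasDerivAt w (r x * w x) x)
    (hq : ∀ x ∈ Icc a b, HasDerivAt q (q' x) x)
    (hLq : ∀ x ∈ Icc a b, L ≤ - q' x + q x * r x - q x ^ 2)
    (hc : ContinuousOn h (Icc a b)) (hc' : ContinuousOn h' (Icc a b))
    (hd : ∀ x ∈ Icc a b, HasDerivAt h (h' x) x)
    (hm : ∫ x in a..b, h x * w x = 0) :
    L * ∫ x in a..b, h x ^ 2 * w x ≤ ∫ x in a..b, h' x ^ 2 * w x := by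
  obtain ⟨Hc, Hd⟩ := ah_primitive hab (u := fun x => h x * w x) (by fun_prop)
  set H : ℝ → ℝ := fun x => ∫ t in a..x, h t * w t with hH
  have H0 : H a = 0 := by simp [hH]
  have H1 : H b = 0 := hm
  have i1 : IntervalIntegrable (fun x => h x ^ 2 * w x) volume a b := by
    apply ContinuousOn.intervalIntegrable; rw [uIcc_of_le hab]; fun_prop
  have i2 : IntervalIntegrable (fun x => h' x ^ 2 * w x) volume a b := by
    apply ContinuousOn.intervalIntegrable; rw [uIcc_of_le hab]; fun_prop
  have key := intervalIntegral.sub_le_integral_of_hasDeriv_right_of_le (a := a) (b := b)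
    (g := fun x => L * (q x * (H x ^ 2) / w x) - 2 * L * (h x * H x))
    (g' := fun x => L * ((q' x - q x * r x) * H x ^ 2 / w x + 2 * q x * H x * h x)
      - 2 * L * (h' x * H x + h x ^ 2 * w x))
    (φ := fun x => h' x ^ 2 * w x - L * (h x ^ 2 * w x)) hab
    (ContinuousOn.sub (continuousOn_const.mul ((hqc.mul (Hc.pow 2)).div hwc fun x hx => (hw0 x hx).ne')) (by fun_prop)) ?_ ?_ ?_
  · rw [intervalIntegral.integral_sub i2 (i1.const_mul _), intervalIntegral.integral_const_mul] at key
    simp only [H0, H1] at key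
    simp at key
    linarith
  · intro x hx
    have hx' := Ioo_subset_Icc_self hx
    have hwx := (hw0 x hx').ne'
    apply HasDerivAt.hasDerivWithinAt
    have d1 := ((((hq x hx').mul ((Hd x hx).pow 2)).div (hw x hx') hwx).const_mul L).sub
      (((hd x hx').mul (Hd x hx)).const_mul (2 * L))
    refine d1.congr_deriv ?_
    simp
    field_simp
    ring
  · exact ContinuousOn.integrableOn_Icc (by fun_prop)
  · intro x hx
    have hx' := Ioo_subset_Icc_self hx
    have hwx := hw0 x hx'
    have hl := hLq x hx'
    have s1 : 0 ≤ (h' x + L * H x / w x) ^ 2 * w x := by positivity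
    have s2 : 0 ≤ L * ((h x - q x * H x / w x) ^ 2 * w x) := by positivity
    have s3 : 0 ≤ L * ((- q' x + q x * r x - q x ^ 2 - L) * (H x ^ 2 / w x)) :=
      mul_nonneg hL (mul_nonneg (by linarith) (by positivity))
    refine sub_nonneg.1 ((add_nonneg (add_nonneg s1 s2) s3).trans_eq ?_)
    field_simp
    ring

lemma ah_angular_c {α c : ℝ} (hα : 0 < α) (hα' : α ≤ π/6) (hc0 : 0 < c) (hc3 : c < 3) (n : ℕ)
    {h h' : ℝ → ℝ}
    (hc : ContinuousOn h (Icc (π/2 - α) (π/2 + α))) (hc' : ContinuousOn h' (Icc (π/2 - α) (π/2 + α)))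
    (hd : ∀ x ∈ Icc (π/2 - α) (π/2 + α), HasDerivAt h (h' x) x)
    (hm : ∫ x in (π/2 - α)..(π/2 + α), h x * sin x ^ n = 0) :
    (c ^ 2 + n / 2) * ∫ x in (π/2 - α)..(π/2 + α), h x ^ 2 * sin x ^ n
      ≤ ∫ x in (π/2 - α)..(π/2 + α), h' x ^ 2 * sin x ^ n := by
  have hpi := Real.pi_pos
  have hs : ∀ x ∈ Icc (π/2 - α) (π/2 + α), 0 < sin x := fun x hx =>
    sin_pos_of_pos_of_lt_pi (by linarith [hx.1]) (by linarith [hx.2])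
  have hcs : ∀ x ∈ Icc (π/2 - α) (π/2 + α), 0 < cos (c * (x - π/2)) := fun x hx => by
    apply cos_pos_of_mem_Ioo
    have h1 : -α ≤ x - π/2 := by linarith [hx.1]
    have h2 : x - π/2 ≤ α := by linarith [hx.2]
    constructor <;> nlinarith
  have hq : ∀ x ∈ Icc (π/2 - α) (π/2 + α),
      HasDerivAt (fun x => (n:ℝ) / 2 * (cos x / sin x) - c * (sin (c * (x - π/2)) / cos (c * (x - π/2))))
        (-((n:ℝ) / 2 * (1 + (cos x / sin x) ^ 2))
          - c ^ 2 * (1 + (sin (c * (x - π/2)) / cos (c * (x - π/2))) ^ 2)) x := by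
    intro x hx
    have h1 := (hs x hx).ne'
    have h2 := (hcs x hx).ne'
    have dl : HasDerivAt (fun x => c * (x - π/2)) c x := by
      simpa using ((hasDerivAt_id x).sub_const (π/2)).const_mul c
    refine ((((hasDerivAt_cos x).div (hasDerivAt_sin x) h1).const_mul ((n:ℝ) / 2)).sub
      ((dl.sin.div dl.cos h2).const_mul c)).congr_deriv ?_
    generalize c * (x - π/2) = y at *
    field_simp
    ring
  refine ah_poincare (w := fun x => sin x ^ n) (r := fun x => n * (cos x / sin x)) (by linarith)
    (by positivity) (fun x hx => pow_pos (hs x hx) n) (by fun_prop)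
    (fun x hx => (hq x hx).continuousAt.continuousWithinAt) ?_ hq ?_ hc hc' hd hm
  · intro x hx
    have h1 := (hs x hx).ne'
    refine ((hasDerivAt_sin x).pow n).congr_deriv ?_
    rcases n with _ | n
    · simp
    · simp only [Nat.add_sub_cancel, pow_succ]
      field_simp
  · intro x hx
    have : 0 ≤ ((n:ℝ) / 2 + n ^ 2 / 4) * (cos x / sin x) ^ 2 := by positivity
    generalize cos x / sin x = t at *
    generalize sin (c * (x - π/2)) / cos (c * (x - π/2)) = T at *
    nlinarith

lemma ah_angular {α : ℝ} (hα : 0 < α) (hα' : α ≤ π/6) (n : ℕ)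
    {h h' : ℝ → ℝ}
    (hc : ContinuousOn h (Icc (π/2 - α) (π/2 + α))) (hc' : ContinuousOn h' (Icc (π/2 - α) (π/2 + α)))
    (hd : ∀ x ∈ Icc (π/2 - α) (π/2 + α), HasDerivAt h (h' x) x)
    (hm : ∫ x in (π/2 - α)..(π/2 + α), h x * sin x ^ n = 0) :
    (9 + (n:ℝ) / 2) * ∫ x in (π/2 - α)..(π/2 + α), h x ^ 2 * sin x ^ n
      ≤ ∫ x in (π/2 - α)..(π/2 + α), h' x ^ 2 * sin x ^ n := by
  set A := ∫ x in (π/2 - α)..(π/2 + α), h x ^ 2 * sin x ^ n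
  have ht : Filter.Tendsto (fun c : ℝ => (c ^ 2 + (n:ℝ) / 2) * A) (nhdsWithin 3 (Iio 3))
      (nhds ((3 ^ 2 + (n:ℝ) / 2) * A)) := by
    have : Continuous (fun c : ℝ => (c ^ 2 + (n:ℝ) / 2) * A) := by fun_prop
    exact this.continuousAt.tendsto.mono_left nhdsWithin_le_nhds
  have := le_of_tendsto ht (b := ∫ x in (π/2 - α)..(π/2 + α), h' x ^ 2 * sin x ^ n) (by
    filter_upwards [Ioo_mem_nhdsLT (show (0:ℝ) < 3 by norm_num)] with c hcc
    exact ah_angular_c hα hα' hcc.1 hcc.2 n hc hc' hd hm)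
  norm_num at this
  exact this

lemma ah_var {a b : ℝ} (hab : a ≤ b) {w u : ℝ → ℝ} (hw : ContinuousOn w (Icc a b))
    (hu : ContinuousOn u (Icc a b)) (s : ℝ) :
    ∫ x in a..b, (u x - s) ^ 2 * w x
      = (∫ x in a..b, u x ^ 2 * w x) - 2 * s * (∫ x in a..b, u x * w x) + s ^ 2 * ∫ x in a..b, w x := by
  have i1 : IntervalIntegrable (fun x => u x ^ 2 * w x) volume a b := by
    apply ContinuousOn.intervalIntegrable; rw [uIcc_of_le hab]; fun_prop
  have i2 : IntervalIntegrable (fun x => u x * w x) volume a b := by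
    apply ContinuousOn.intervalIntegrable; rw [uIcc_of_le hab]; fun_prop
  have i3 : IntervalIntegrable (fun x => w x) volume a b := by
    apply ContinuousOn.intervalIntegrable; rw [uIcc_of_le hab]; fun_prop
  rw [← intervalIntegral.integral_const_mul, ← intervalIntegral.integral_const_mul,
    ← intervalIntegral.integral_sub i1 (i2.const_mul _),
    ← intervalIntegral.integral_add (i1.sub (i2.const_mul _)) (i3.const_mul _)]
  congr 1
  ext x
  ring

lemma ah_final {ε W A B : ℝ} {j : ℕ} (he0 : 0 < ε) (he1 : ε ≤ 1) (hW : 0 < W) (hA : 0 ≤ A)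
    (hB : 0 ≤ B) {g g' S R P : ℝ → ℝ}
    (cg : ContinuousOn g (Icc ε 1)) (cg' : ContinuousOn g' (Icc ε 1))
    (cS : ContinuousOn S (Icc ε 1)) (cR : ContinuousOn R (Icc ε 1)) (cP : ContinuousOn P (Icc ε 1))
    (hrad : ∀ x ∈ Icc ε 1, g' x ^ 2 * W ≤ R x)
    (hang : ∀ x ∈ Icc ε 1, S x ≤ g x ^ 2 * W + B * P x)
    (hR : ∫ x in ε..1, g x ^ 2 * x ^ j ≤ A * ∫ x in ε..1, g' x ^ 2 * x ^ (j + 2)) :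
    2 * π * (∫ x in ε..1, x ^ j * S x) ≤ A * (2 * π * ∫ x in ε..1, x ^ (j + 2) * R x)
      + B * (2 * π * ∫ x in ε..1, x ^ j * P x) := by
  have ii : ∀ {u : ℝ → ℝ}, ContinuousOn u (Icc ε 1) → IntervalIntegrable u volume ε 1 := by
    intro u hu
    apply ContinuousOn.intervalIntegrable
    rwa [uIcc_of_le he1]
  have h1 : ∫ x in ε..1, x ^ j * S x ≤ ∫ x in ε..1, (W * (g x ^ 2 * x ^ j) + B * (x ^ j * P x)) := by
    refine intervalIntegral.integral_mono_on he1 (ii (by fun_prop)) (ii (by fun_prop)) fun x hx => ?_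
    have hx0 : 0 ≤ x ^ j := pow_nonneg (he0.le.trans hx.1) j
    have := mul_le_mul_of_nonneg_left (hang x hx) hx0
    linarith
  rw [intervalIntegral.integral_add (ii (by fun_prop)) (ii (by fun_prop)),
    intervalIntegral.integral_const_mul, intervalIntegral.integral_const_mul] at h1
  have h2 : ∫ x in ε..1, W * (g' x ^ 2 * x ^ (j + 2)) ≤ ∫ x in ε..1, x ^ (j + 2) * R x := by
    refine intervalIntegral.integral_mono_on he1 (ii (by fun_prop)) (ii (by fun_prop)) fun x hx => ?_
    have hx0 : 0 ≤ x ^ (j + 2) := pow_nonneg (he0.le.trans hx.1) _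
    have := mul_le_mul_of_nonneg_left (hrad x hx) hx0
    linarith
  rw [intervalIntegral.integral_const_mul] at h2
  have h3 := mul_le_mul_of_nonneg_left hR hW.le
  have h4 := mul_le_mul_of_nonneg_left h2 hA
  have h5 := mul_le_mul_of_nonneg_left (h1.trans (add_le_add_left (h3.trans ((by ring : _ = _).le.trans h4)) _))
    (by positivity : 0 ≤ 2 * π)
  linarith

/-- Anisotropic Hardy inequality on the truncated conical shell
`D_m = {1/m < ρ < 1, π/2-α < φ < π/2+α}` (spherical coordinates, axisymmetric,
`dx = 2πρ² sin φ dρ dφ`): for integers `i ≥ -2`, `k ≥ -1`, `0 ≤ j ≤ i+2` and `f` with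
`∫ f ρⁱ sinᵏφ dx = 0`, one has
`∫ (f/ρ)² ρʲ sinᵏφ dx ≤ (4/(j+1)²)∫|∂_ρ f|² ρʲ sinᵏφ dx + (2/(19+k))∫|ρ⁻¹∂_φ f|² ρʲ sinᵏφ dx`. -/
theorem anisotropic_hardy_Dm (m : ℕ) (hm : 1000 ≤ m) (α : ℝ) (hα : 0 < α) (hα' : α ≤ π/6)
    (i j k : ℤ) (hi : -2 ≤ i) (hk : -1 ≤ k) (hj0 : 0 ≤ j) (hj : j ≤ i + 2)
    (f fr fp : ℝ → ℝ → ℝ)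
    (hcf : ContinuousOn (fun p : ℝ × ℝ => f p.1 p.2)
      (Set.Icc (1/(m:ℝ)) 1 ×ˢ Set.Icc (π/2 - α) (π/2 + α)))
    (hcr : ContinuousOn (fun p : ℝ × ℝ => fr p.1 p.2)
      (Set.Icc (1/(m:ℝ)) 1 ×ˢ Set.Icc (π/2 - α) (π/2 + α)))
    (hcp : ContinuousOn (fun p : ℝ × ℝ => fp p.1 p.2)
      (Set.Icc (1/(m:ℝ)) 1 ×ˢ Set.Icc (π/2 - α) (π/2 + α)))
    (hdr : ∀ ρ ∈ Set.Icc (1/(m:ℝ)) 1, ∀ φ ∈ Set.Icc (π/2 - α) (π/2 + α),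
      HasDerivAt (fun s => f s φ) (fr ρ φ) ρ)
    (hdp : ∀ ρ ∈ Set.Icc (1/(m:ℝ)) 1, ∀ φ ∈ Set.Icc (π/2 - α) (π/2 + α),
      HasDerivAt (fun t => f ρ t) (fp ρ φ) φ)
    (hmean : (∫ ρ in (1/(m:ℝ))..1, ∫ φ in (π/2 - α)..(π/2 + α),
        f ρ φ * ρ ^ i * Real.sin φ ^ k * (2*π*ρ^2*Real.sin φ)) = 0) :
    (∫ ρ in (1/(m:ℝ))..1, ∫ φ in (π/2 - α)..(π/2 + α),
        (f ρ φ / ρ) ^ 2 * ρ ^ j * Real.sin φ ^ k * (2*π*ρ^2*Real.sin φ))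
      ≤ (4 / ((j : ℝ) + 1)^2) * (∫ ρ in (1/(m:ℝ))..1, ∫ φ in (π/2 - α)..(π/2 + α),
            fr ρ φ ^ 2 * ρ ^ j * Real.sin φ ^ k * (2*π*ρ^2*Real.sin φ))
        + (2 / (19 + (k : ℝ))) * (∫ ρ in (1/(m:ℝ))..1, ∫ φ in (π/2 - α)..(π/2 + α),
            (fp ρ φ / ρ) ^ 2 * ρ ^ j * Real.sin φ ^ k * (2*π*ρ^2*Real.sin φ)) := by
  have hpi := Real.pi_pos
  have hm1 : (1000:ℝ) ≤ m := by exact_mod_cast hm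
  have he0 : 0 < 1 / (m:ℝ) := by positivity
  have he1 : 1 / (m:ℝ) ≤ 1 := by rw [div_le_one (by linarith)]; linarith
  generalize 1 / (m:ℝ) = ε at *
  obtain ⟨j, rfl⟩ := Int.eq_ofNat_of_zero_le hj0
  obtain ⟨d, hd⟩ := Int.eq_ofNat_of_zero_le (show 0 ≤ i + 2 - j by linarith)
  obtain ⟨n, hn⟩ := Int.eq_ofNat_of_zero_le (show 0 ≤ k + 1 by linarith)
  have hab : π/2 - α ≤ π/2 + α := by linarith
  have hs : ∀ x ∈ Icc (π/2 - α) (π/2 + α), 0 < sin x := fun x hx =>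
    sin_pos_of_pos_of_lt_pi (by linarith [hx.1]) (by linarith [hx.2])
  have hsk : ∀ x ∈ Icc (π/2 - α) (π/2 + α), sin x ^ k * sin x = sin x ^ n := fun x hx => by
    rw [← zpow_natCast, ← hn, zpow_add_one₀ (hs x hx).ne']
  have hri : ∀ x ∈ Icc ε 1, x ^ i * x ^ 2 = x ^ (j + d) := fun x hx => by
    have hx0 : x ≠ 0 := (he0.trans_le hx.1).ne'
    rw [← zpow_natCast, ← zpow_natCast, ← zpow_add₀ hx0]
    congr 1
    push_cast at hd ⊢
    linarith
  have hkr : (19:ℝ) + k = 18 + n := by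
    have : (k:ℝ) + 1 = n := by exact_mod_cast hn
    linarith
  rw [hkr]
  clear hkr
  -- uniform rewriting of the double integrals
  have conv : ∀ (G F : ℝ → ℝ → ℝ) (e : ℕ),
      (∀ ρ ∈ Icc ε 1, ∀ φ ∈ Icc (π/2 - α) (π/2 + α), G ρ φ = 2 * π * (ρ ^ e * (F ρ φ * sin φ ^ n))) →
      (∫ ρ in ε..1, ∫ φ in (π/2 - α)..(π/2 + α), G ρ φ)
        = 2 * π * ∫ ρ in ε..1, ρ ^ e * ∫ φ in (π/2 - α)..(π/2 + α), F ρ φ * sin φ ^ n := by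
    intro G F e h
    rw [← intervalIntegral.integral_const_mul]
    refine intervalIntegral.integral_congr fun ρ hρ => ?_
    rw [uIcc_of_le he1] at hρ
    rw [← intervalIntegral.integral_const_mul, ← intervalIntegral.integral_const_mul]
    refine intervalIntegral.integral_congr fun φ hφ => ?_
    rw [uIcc_of_le hab] at hφ
    exact h ρ hρ φ hφ
  rw [conv _ f (j + d) (fun ρ hρ φ hφ => by rw [← hri ρ hρ, ← hsk φ hφ]; ring)] at hmean
  rw [conv _ (fun ρ φ => f ρ φ ^ 2) j (fun ρ hρ φ hφ => by
      have hx0 : ρ ≠ 0 := (he0.trans_le hρ.1).ne'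
      rw [← hsk φ hφ, zpow_natCast]; field_simp),
    conv _ (fun ρ φ => fr ρ φ ^ 2) (j + 2) (fun ρ hρ φ hφ => by
      rw [← hsk φ hφ, zpow_natCast]; ring),
    conv _ (fun ρ φ => fp ρ φ ^ 2) j (fun ρ hρ φ hφ => by
      have hx0 : ρ ≠ 0 := (he0.trans_le hρ.1).ne'
      rw [← hsk φ hφ, zpow_natCast]; field_simp)]
  have hmean' := (mul_eq_zero.1 hmean).resolve_left (by positivity)
  clear conv hmean
  -- the angular weight
  set W := ∫ φ in (π/2 - α)..(π/2 + α), sin φ ^ n with hWdef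
  have hW : 0 < W := by
    apply intervalIntegral.intervalIntegral_pos_of_pos_on
    · exact (by fun_prop : Continuous fun x : ℝ => sin x ^ n).intervalIntegrable _ _
    · intro x hx; exact pow_pos (hs x (Ioo_subset_Icc_self hx)) n
    · linarith
  have slice : ∀ {K : ℝ → ℝ → ℝ}, ContinuousOn (fun p : ℝ × ℝ => K p.1 p.2)
      (Icc ε 1 ×ˢ Icc (π/2 - α) (π/2 + α)) → ∀ s ∈ Icc ε 1,
      ContinuousOn (K s) (Icc (π/2 - α) (π/2 + α)) := by
    intro K hK s hs
    exact hK.comp (f := fun y => (s, y)) (by fun_prop) (fun y hy => ⟨hs, hy⟩)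
  have cM := ah_cont he1 hab (F := fun ρ φ => f ρ φ * sin φ ^ n) (by fun_prop)
  have cM' := ah_cont he1 hab (F := fun ρ φ => fr ρ φ * sin φ ^ n) (by fun_prop)
  have cS := ah_cont he1 hab (F := fun ρ φ => f ρ φ ^ 2 * sin φ ^ n) (by fun_prop)
  have cR := ah_cont he1 hab (F := fun ρ φ => fr ρ φ ^ 2 * sin φ ^ n) (by fun_prop)
  have cP := ah_cont he1 hab (F := fun ρ φ => fp ρ φ ^ 2 * sin φ ^ n) (by fun_prop)
  have dM := ah_deriv (a := ε) (b := 1) hab (F := fun ρ φ => f ρ φ * sin φ ^ n)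
    (G := fun ρ φ => fr ρ φ * sin φ ^ n) (by fun_prop) (by fun_prop)
    (fun x hx y hy => (hdr x hx y hy).mul_const _)
  have hrad : ∀ ρ ∈ Icc ε 1, ((∫ φ in (π/2 - α)..(π/2 + α), fr ρ φ * sin φ ^ n) / W) ^ 2 * W
      ≤ ∫ φ in (π/2 - α)..(π/2 + α), fr ρ φ ^ 2 * sin φ ^ n := by
    intro ρ hρ
    set s := (∫ φ in (π/2 - α)..(π/2 + α), fr ρ φ * sin φ ^ n) / W with hsdef
    have hsW : ∫ φ in (π/2 - α)..(π/2 + α), fr ρ φ * sin φ ^ n = s * W := by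
      rw [hsdef]; field_simp
    have h1 := ah_var hab (w := fun φ => sin φ ^ n) (by fun_prop) (slice hcr ρ hρ) s
    have h2 : 0 ≤ ∫ φ in (π/2 - α)..(π/2 + α), (fr ρ φ - s) ^ 2 * sin φ ^ n :=
      intervalIntegral.integral_nonneg hab fun φ hφ =>
        mul_nonneg (sq_nonneg _) (pow_pos (hs φ hφ) n).le
    rw [h1, hsW, ← hWdef] at h2
    nlinarith
  have hang : ∀ ρ ∈ Icc ε 1, (∫ φ in (π/2 - α)..(π/2 + α), f ρ φ ^ 2 * sin φ ^ n)
      ≤ ((∫ φ in (π/2 - α)..(π/2 + α), f ρ φ * sin φ ^ n) / W) ^ 2 * W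
       + 2 / (18 + (n:ℝ)) * ∫ φ in (π/2 - α)..(π/2 + α), fp ρ φ ^ 2 * sin φ ^ n := by
    intro ρ hρ
    set s := (∫ φ in (π/2 - α)..(π/2 + α), f ρ φ * sin φ ^ n) / W with hsdef
    have hsW : ∫ φ in (π/2 - α)..(π/2 + α), f ρ φ * sin φ ^ n = s * W := by
      rw [hsdef]; field_simp
    have hfc := slice hcf ρ hρ
    have h1 := ah_var hab (w := fun φ => sin φ ^ n) (by fun_prop) hfc s
    have h2 := ah_angular hα hα' n (h := fun φ => f ρ φ - s) (h' := fp ρ)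
      (hfc.sub continuousOn_const) (slice hcp ρ hρ)
      (fun φ hφ => (hdp ρ hρ φ hφ).sub_const s) (by
        have i1 : IntervalIntegrable (fun φ => f ρ φ * sin φ ^ n) volume (π/2 - α) (π/2 + α) := by
          apply ContinuousOn.intervalIntegrable; rw [uIcc_of_le hab]
          exact hfc.mul (by fun_prop)
        have i2 : IntervalIntegrable (fun φ => s * sin φ ^ n) volume (π/2 - α) (π/2 + α) :=
          (by fun_prop : Continuous fun x : ℝ => s * sin x ^ n).intervalIntegrable _ _
        simp only [sub_mul]
        rw [intervalIntegral.integral_sub i1 i2, hsW, intervalIntegral.integral_const_mul, ← hWdef,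
          sub_self])
    rw [h1, hsW, ← hWdef] at h2
    have hn0 : (0:ℝ) < 18 + n := by positivity
    rw [← sub_le_iff_le_add', div_mul_eq_mul_div, le_div_iff₀ hn0]
    linarith
  have hR := ah_radial he0 he1 j d
    (g := fun ρ => (∫ φ in (π/2 - α)..(π/2 + α), f ρ φ * sin φ ^ n) / W)
    (g' := fun ρ => (∫ φ in (π/2 - α)..(π/2 + α), fr ρ φ * sin φ ^ n) / W)
    (cM.div_const W) (cM'.div_const W) (fun x hx => (dM x hx).div_const W) (by
      have e : ∀ x : ℝ, (∫ φ in (π/2 - α)..(π/2 + α), f x φ * sin φ ^ n) / W * x ^ (j + d)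
        = W⁻¹ * (x ^ (j + d) * ∫ φ in (π/2 - α)..(π/2 + α), f x φ * sin φ ^ n) := fun x => by
          field_simp
      simp only [e]
      rw [intervalIntegral.integral_const_mul, hmean', mul_zero])
  have hcast : (((j : ℤ)) : ℝ) = (j:ℝ) := by simp
  rw [hcast]
  exact ah_final he0 he1 hW (by positivity) (by positivity) (cM.div_const W) (cM'.div_const W)
    cS cR cP hrad hang hR
end

section
/- Let m ≥ 1000 and 0 < α ≤ π/6. For every axisymmetric v_θ ∈ H¹(D_m) with ∫_{D_m} ρ sin φ · v_θ dx = 0, setting f = v_θ or f = v_θ/ρ, one has ∫_{D_m} f²/ρ² dx ≤ (8/√3)∫_{D_m}|∂_ρ f|² dx + (1/(5√3))∫_{D_m}|ρ⁻¹∂_φ f|² dx. -/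
open MeasureTheory Real Set

lemma hv_param_cont {F : ℝ → ℝ → ℝ} {a b c d : ℝ} (hab : a ≤ b) (hcd : c ≤ d)
    (hF : ContinuousOn (fun p : ℝ × ℝ => F p.1 p.2) (Icc a b ×ˢ Icc c d)) :
    ContinuousOn (fun x => ∫ y in c..d, F x y) (Icc a b) := by
  have h1 : Continuous (fun p : ℝ × ℝ => F (max a (min b p.1)) (max c (min d p.2))) := by
    have h2 : Continuous (fun p : ℝ × ℝ => (max a (min b p.1), max c (min d p.2))) := by fun_prop
    have := hF.comp_continuous h2 (fun p => by
      refine ⟨⟨le_max_left _ _, ?_⟩, ⟨le_max_left _ _, ?_⟩⟩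
      · exact max_le hab (min_le_left _ _)
      · exact max_le hcd (min_le_left _ _))
    exact this
  have h3 : Continuous (fun x : ℝ => ∫ y in c..d, F (max a (min b x)) (max c (min d y))) :=
    intervalIntegral.continuous_parametric_intervalIntegral_of_continuous' (f := fun x y => F (max a (min b x)) (max c (min d y))) h1 c d
  refine h3.continuousOn.congr ?_
  intro x hx
  apply intervalIntegral.integral_congr
  intro y hy
  rw [uIcc_of_le hcd] at hy
  simp only [min_eq_right hx.2, max_eq_right hx.1, min_eq_right hy.2, max_eq_right hy.1]

lemma hv_slice {F : ℝ → ℝ → ℝ} {a b c d : ℝ}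
    (hF : ContinuousOn (fun p : ℝ × ℝ => F p.1 p.2) (Icc a b ×ˢ Icc c d)) {x : ℝ}
    (hx : x ∈ Icc a b) : ContinuousOn (fun y => F x y) (Icc c d) := by
  have : ContinuousOn (fun y : ℝ => (x, y)) (Icc c d) := by fun_prop
  exact hF.comp this (fun y hy => ⟨hx, hy⟩)

lemma hv_param_deriv {F F' : ℝ → ℝ → ℝ} {a b c d : ℝ} (hcd : c ≤ d)
    (hF : ContinuousOn (fun p : ℝ × ℝ => F p.1 p.2) (Icc a b ×ˢ Icc c d))
    (hF' : ContinuousOn (fun p : ℝ × ℝ => F' p.1 p.2) (Icc a b ×ˢ Icc c d))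
    (hd : ∀ x ∈ Icc a b, ∀ y ∈ Icc c d, HasDerivAt (fun s => F s y) (F' x y) x)
    {x : ℝ} (hx : x ∈ Ioo a b) :
    HasDerivAt (fun s => ∫ y in c..d, F s y) (∫ y in c..d, F' x y) x := by
  obtain ⟨B, hB⟩ := (isCompact_Icc.prod isCompact_Icc).exists_bound_of_continuousOn hF'
  have hsub : uIoc c d ⊆ Icc c d := by rw [uIoc_of_le hcd]; exact Ioc_subset_Icc_self
  refine (intervalIntegral.hasDerivAt_integral_of_dominated_loc_of_deriv_le (s := Ioo a b)
    (bound := fun _ => B) (Ioo_mem_nhds hx.1 hx.2) ?_ ?_ ?_ ?_ ?_ ?_).2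
  · filter_upwards [Ioo_mem_nhds hx.1 hx.2] with s hs
    exact ((hv_slice hF (Ioo_subset_Icc_self hs)).mono hsub).aestronglyMeasurable measurableSet_uIoc
  · apply ContinuousOn.intervalIntegrable
    rw [uIcc_of_le hcd]
    exact hv_slice hF (Ioo_subset_Icc_self hx)
  · exact ((hv_slice hF' (Ioo_subset_Icc_self hx)).mono hsub).aestronglyMeasurable measurableSet_uIoc
  · refine Filter.Eventually.of_forall fun y hy s hs => ?_
    exact hB (s, y) ⟨Ioo_subset_Icc_self hs, hsub hy⟩
  · exact intervalIntegrable_const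
  · refine Filter.Eventually.of_forall fun y hy s hs => ?_
    exact hd s (Ioo_subset_Icc_self hs) y (hsub hy)

lemma hv_ii {f : ℝ → ℝ} {a b : ℝ} (hab : a ≤ b) (hf : ContinuousOn f (Icc a b)) :
    IntervalIntegrable f volume a b := by
  apply ContinuousOn.intervalIntegrable
  rwa [uIcc_of_le hab]

lemma hv_cs {u v w : ℝ → ℝ} {a b : ℝ} (hab : a ≤ b) (hu : ContinuousOn u (Icc a b))
    (hv : ContinuousOn v (Icc a b)) (hw : ContinuousOn w (Icc a b))
    (hw0 : ∀ x ∈ Icc a b, 0 ≤ w x) :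
    (∫ x in a..b, u x * v x * w x) ^ 2
      ≤ (∫ x in a..b, u x ^ 2 * w x) * (∫ x in a..b, v x ^ 2 * w x) := by
  have i1 : IntervalIntegrable (fun x => u x ^ 2 * w x) volume a b := hv_ii hab (by fun_prop)
  have i2 : IntervalIntegrable (fun x => u x * v x * w x) volume a b := hv_ii hab (by fun_prop)
  have i3 : IntervalIntegrable (fun x => v x ^ 2 * w x) volume a b := hv_ii hab (by fun_prop)
  have key : ∀ t : ℝ, 0 ≤ (∫ x in a..b, u x ^ 2 * w x) * (t * t)
      + (2 * ∫ x in a..b, u x * v x * w x) * t + ∫ x in a..b, v x ^ 2 * w x := by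
    intro t
    have h0 : 0 ≤ ∫ x in a..b, (t * u x + v x) ^ 2 * w x :=
      intervalIntegral.integral_nonneg hab fun x hx => mul_nonneg (sq_nonneg _) (hw0 x hx)
    have h1 : ∫ x in a..b, (t * u x + v x) ^ 2 * w x
        = ∫ x in a..b, ((t * t) * (u x ^ 2 * w x) + (2 * t) * (u x * v x * w x) + v x ^ 2 * w x) := by
      congr 1; ext x; ring
    rw [h1, intervalIntegral.integral_add ((i1.const_mul _).add (i2.const_mul _)) i3,
      intervalIntegral.integral_add (i1.const_mul _) (i2.const_mul _),
      intervalIntegral.integral_const_mul, intervalIntegral.integral_const_mul] at h0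
    linarith
  have := discrim_le_zero key
  unfold discrim at this
  nlinarith

lemma hv_oneD {ε : ℝ} (he0 : 0 < ε) (he1 : ε ≤ 1 / 1000) (n : ℕ) (hn : n = 3 ∨ n = 4)
    {g g' e : ℝ → ℝ} (hg : ContinuousOn g (Icc ε 1)) (hg' : ContinuousOn g' (Icc ε 1))
    (he : ContinuousOn e (Icc ε 1)) (hd : ∀ x ∈ Ioo ε 1, HasDerivAt g (g' x) x)
    (hz : ∫ x in ε..1, x ^ n * (g x + e x) = 0) :
    ∫ x in ε..1, g x ^ 2 ≤ 4 * (∫ x in ε..1, x ^ 2 * g' x ^ 2) + 5 * ∫ x in ε..1, e x ^ 2 := by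
  have hab : ε ≤ 1 := by linarith
  have j1 : IntervalIntegrable (fun x => g x ^ 2) volume ε 1 := hv_ii hab (by fun_prop)
  have j2 : IntervalIntegrable (fun x => x ^ 2 * g' x ^ 2) volume ε 1 := hv_ii hab (by fun_prop)
  have j3 : IntervalIntegrable (fun x => x ^ n * g x) volume ε 1 := hv_ii hab (by fun_prop)
  have j4 : IntervalIntegrable (fun x => x ^ n * e x) volume ε 1 := hv_ii hab (by fun_prop)
  have j5 : IntervalIntegrable (fun x => x * g x * g' x) volume ε 1 := hv_ii hab (by fun_prop)
  have j6 : IntervalIntegrable (fun x => x ^ (n + 1) * g' x) volume ε 1 := hv_ii hab (by fun_prop)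
  have p1 : ∫ x in ε..1, (g x ^ 2 + 2 * (x * g x * g' x)) = g 1 ^ 2 - ε * g ε ^ 2 := by
    have := intervalIntegral.integral_eq_sub_of_hasDerivAt_of_le (f := fun x => x * g x ^ 2)
      (f' := fun x => g x ^ 2 + 2 * (x * g x * g' x)) hab (by fun_prop)
      (fun x hx => by
        have := (hasDerivAt_id x).mul ((hd x hx).pow 2)
        refine this.congr_deriv ?_
        simp; ring) (j1.add (j5.const_mul 2))
    rw [this]; simp
  have p2 : ∫ x in ε..1, ((n + 1 : ℝ) * (x ^ n * g x) + x ^ (n + 1) * g' x)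
      = g 1 - ε ^ (n + 1) * g ε := by
    have := intervalIntegral.integral_eq_sub_of_hasDerivAt_of_le (f := fun x => x ^ (n + 1) * g x)
      (f' := fun x => (n + 1 : ℝ) * (x ^ n * g x) + x ^ (n + 1) * g' x) hab (by fun_prop)
      (fun x hx => by
        have := (hasDerivAt_pow (n + 1) x).mul (hd x hx)
        refine this.congr_deriv ?_
        simp; ring) ((j3.const_mul _).add j6)
    rw [this]; simp
  rw [intervalIntegral.integral_add j1 (j5.const_mul 2), intervalIntegral.integral_const_mul] at p1
  rw [intervalIntegral.integral_add (j3.const_mul _) j6, intervalIntegral.integral_const_mul] at p2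
  have hz' : (∫ x in ε..1, x ^ n * g x) + ∫ x in ε..1, x ^ n * e x = 0 := by
    rw [← intervalIntegral.integral_add j3 j4, ← hz]
    congr 1; ext x; ring
  have zz : ∫ x in ε..1, (x * g' x + g x / 2) ^ 2 * 1
      = (∫ x in ε..1, x ^ 2 * g' x ^ 2) + (∫ x in ε..1, x * g x * g' x)
        + (1 / 4) * ∫ x in ε..1, g x ^ 2 := by
    rw [← intervalIntegral.integral_const_mul, ← intervalIntegral.integral_add j2 j5,
      ← intervalIntegral.integral_add (j2.add j5) (j1.const_mul _)]
    congr 1; ext x; ring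
  have yy : ∫ x in ε..1, x ^ n * (x * g' x + g x / 2) * 1
      = (∫ x in ε..1, x ^ (n + 1) * g' x) + (1 / 2) * ∫ x in ε..1, x ^ n * g x := by
    rw [← intervalIntegral.integral_const_mul, ← intervalIntegral.integral_add j6 (j3.const_mul _)]
    congr 1; ext x; ring
  have rr : ∫ x in ε..1, (x ^ n) ^ 2 * 1 ≤ 1 / (2 * (n : ℝ) + 1) := by
    have : ∫ x in ε..1, (x ^ n) ^ 2 * 1 = ∫ x in ε..1, x ^ (2 * n) := by
      congr 1; ext x; ring
    rw [this, integral_pow]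
    push_cast
    have : 0 < ε ^ (2 * n + 1) := by positivity
    gcongr
    simp; positivity
  have c1 := hv_cs (u := fun x => x ^ n) (v := fun x => x * g' x + g x / 2) (w := fun _ => 1) hab
    (by fun_prop) (by fun_prop) (by fun_prop) (by simp)
  have c2 := hv_cs (u := fun x => x ^ n) (v := e) (w := fun _ => 1) hab
    (by fun_prop) (by fun_prop) (by fun_prop) (by simp)
  have nz : 0 ≤ ∫ x in ε..1, (x * g' x + g x / 2) ^ 2 * 1 :=
    intervalIntegral.integral_nonneg hab fun x hx => by positivity
  have ne : 0 ≤ ∫ x in ε..1, e x ^ 2 * 1 :=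
    intervalIntegral.integral_nonneg hab fun x hx => by positivity
  have c1' := c1.trans (mul_le_mul_of_nonneg_right rr nz)
  have c2' := c2.trans (mul_le_mul_of_nonneg_right rr ne)
  rw [zz, yy] at c1'
  simp only [mul_one] at c2' ne
  rw [zz] at nz
  have hr : (ε ^ (n + 1) * g ε) ^ 2 * 1000 ≤ ε * g ε ^ 2 := by
    have : ε ^ (2 * n + 1) ≤ ε ^ 1 := pow_le_pow_of_le_one he0.le hab (by omega)
    have h2 : (ε ^ (n + 1) * g ε) ^ 2 * 1000 = (ε ^ (2 * n + 1) * 1000) * (ε * g ε ^ 2) := by ring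
    rw [h2]
    have : 0 ≤ ε * g ε ^ 2 := by positivity
    have : ε ^ (2 * n + 1) * 1000 ≤ 1 := by linarith
    nlinarith
  generalize (∫ x in ε..1, g x ^ 2) = G at *
  generalize (∫ x in ε..1, x ^ 2 * g' x ^ 2) = H at *
  generalize (∫ x in ε..1, e x ^ 2) = E at *
  generalize (∫ x in ε..1, x * g x * g' x) = X at *
  generalize (∫ x in ε..1, x ^ n * g x) = δ at *
  generalize (∫ x in ε..1, x ^ n * e x) = δ' at *
  generalize (∫ x in ε..1, x ^ (n + 1) * g' x) = Y at *
  generalize ε ^ (n + 1) * g ε = r at *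
  generalize ε * g ε ^ 2 = q at *
  generalize g 1 = s at *
  obtain rfl : δ' = -δ := by linarith
  obtain rfl : X = (s ^ 2 - q - G) / 2 := by linarith
  have key : ∀ p t : ℝ, (p + t + r) ^ 2 ≤ 14 * p ^ 2 + 1.1 * t ^ 2 + 1000 * r ^ 2 := by
    intro p t
    nlinarith [sq_nonneg (13 * p - t - r), sq_nonneg (t - 20 * r), sq_nonneg t, sq_nonneg r]
  rcases hn with rfl | rfl
  · obtain rfl : Y = s - r - 4 * δ := by push_cast at p2; linarith
    have := key (s - r - 4 * δ + 1 / 2 * δ) (3.5 * δ)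
    have e2 : s - r - 4 * δ + 1 / 2 * δ + 3.5 * δ + r = s := by ring
    rw [e2] at this
    norm_num at c1' c2' this
    nlinarith
  · obtain rfl : Y = s - r - 5 * δ := by push_cast at p2; linarith
    have := key (s - r - 5 * δ + 1 / 2 * δ) (4.5 * δ)
    have e2 : s - r - 5 * δ + 1 / 2 * δ + 4.5 * δ + r = s := by ring
    rw [e2] at this
    norm_num at c1' c2' this
    nlinarith

lemma hv_half {ω l r c0 k : ℝ} {h h' : ℝ → ℝ} (hω : 0 < ω) (hlr : l ≤ r)
    (hd : ∀ x ∈ Icc l r, HasDerivAt h (h' x) x) (hc' : ContinuousOn h' (Icc l r))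
    (hrange : ∀ x ∈ Icc l r, |ω * (c0 - x)| < π / 2)
    (hsin : ∀ x ∈ Icc l r, 0 ≤ sin x)
    (hcos : ∀ x ∈ Icc l r, tan (ω * (c0 - x)) * cos x ≤ 0)
    (hl : tan (ω * (c0 - l)) * (h l - k) ^ 2 ≤ 0) (hr : 0 ≤ tan (ω * (c0 - r)) * (h r - k) ^ 2) :
    ω ^ 2 * ∫ x in l..r, (h x - k) ^ 2 * sin x ≤ ∫ x in l..r, h' x ^ 2 * sin x := by
  have hc : ContinuousOn h (Icc l r) := fun x hx => (hd x hx).continuousAt.continuousWithinAt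
  have hcosne : ∀ x ∈ Icc l r, cos (ω * (c0 - x)) ≠ 0 := fun x hx => by
    have := abs_lt.1 (hrange x hx)
    exact (cos_pos_of_mem_Ioo ⟨this.1, this.2⟩).ne'
  set T : ℝ → ℝ := fun x => tan (ω * (c0 - x)) with hT
  have hTd : ∀ x ∈ Icc l r, HasDerivAt T (-ω * (1 + T x ^ 2)) x := by
    intro x hx
    have h1 : HasDerivAt (fun x => ω * (c0 - x)) (-ω) x := by
      have := ((hasDerivAt_id x).const_sub c0).const_mul ω
      simpa using this
    have := (Real.hasDerivAt_tan (hcosne x hx)).comp x h1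
    refine this.congr_deriv ?_
    have h2 := hcosne x hx
    simp only [hT, tan_eq_sin_div_cos]
    have h3 := sin_sq_add_cos_sq (ω * (c0 - x))
    field_simp
    rw [add_comm, h3]
  have hTc : ContinuousOn T (Icc l r) := fun x hx => (hTd x hx).continuousAt.continuousWithinAt
  have hsc : ContinuousOn sin (Icc l r) := continuous_sin.continuousOn
  have hcc : ContinuousOn cos (Icc l r) := continuous_cos.continuousOn
  have ftc := intervalIntegral.integral_eq_sub_of_hasDerivAt
    (f := fun x => ω * T x * sin x * (h x - k) ^ 2)
    (f' := fun x => (ω * (-ω * (1 + T x ^ 2)) * sin x + ω * T x * cos x) * (h x - k) ^ 2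
      + ω * T x * sin x * (2 * (h x - k) * h' x)) (a := l) (b := r)
    (fun x hx => by
      rw [uIcc_of_le hlr] at hx
      have := (((hTd x hx).const_mul ω).mul (hasDerivAt_sin x)).mul (((hd x hx).sub_const k).pow 2)
      refine this.congr_deriv ?_
      simp) (hv_ii hlr (by fun_prop))
  have i1 : IntervalIntegrable (fun x => (h x - k) ^ 2 * sin x) volume l r := hv_ii hlr (by fun_prop)
  have hmono : ∫ x in l..r, ((ω * (-ω * (1 + T x ^ 2)) * sin x + ω * T x * cos x) * (h x - k) ^ 2
      + ω * T x * sin x * (2 * (h x - k) * h' x) + ω ^ 2 * ((h x - k) ^ 2 * sin x))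
      ≤ ∫ x in l..r, h' x ^ 2 * sin x := by
    apply intervalIntegral.integral_mono_on hlr (hv_ii hlr (by fun_prop)) (hv_ii hlr (by fun_prop))
    intro x hx
    have a1 : 0 ≤ (h' x - ω * T x * (h x - k)) ^ 2 * sin x := mul_nonneg (sq_nonneg _) (hsin x hx)
    have a2 : ω * (T x * cos x) * (h x - k) ^ 2 ≤ 0 :=
      mul_nonpos_of_nonpos_of_nonneg (mul_nonpos_of_nonneg_of_nonpos hω.le (hcos x hx)) (sq_nonneg _)
    nlinarith
  rw [intervalIntegral.integral_add (hv_ii hlr (by fun_prop)) (i1.const_mul _), ftc,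
    intervalIntegral.integral_const_mul] at hmono
  have b1 : 0 ≤ ω * T r * sin r * (h r - k) ^ 2 := by
    have : 0 ≤ (ω * sin r) * (T r * (h r - k) ^ 2) :=
      mul_nonneg (mul_nonneg hω.le (hsin r ⟨hlr, le_rfl⟩)) hr
    linarith
  have b2 : ω * T l * sin l * (h l - k) ^ 2 ≤ 0 := by
    have : (ω * sin l) * (T l * (h l - k) ^ 2) ≤ 0 :=
      mul_nonpos_of_nonneg_of_nonpos (mul_nonneg hω.le (hsin l ⟨le_rfl, hlr⟩)) hl
    linarith
  linarith

lemma hv_sin_lb {α x : ℝ} (hα' : α ≤ π / 6) (hx : x ∈ Icc (π / 2 - α) (π / 2 + α)) :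
    √3 / 2 ≤ sin x := by
  rw [← cos_pi_div_two_sub, ← cos_abs, ← cos_pi_div_six]
  apply cos_le_cos_of_nonneg_of_le_pi (abs_nonneg _)
  · linarith [pi_pos]
  · rw [abs_le]; constructor <;> linarith [hx.1, hx.2]

lemma hv_poincare {α : ℝ} (hα : 0 < α) (hα' : α ≤ π / 6) {h h' : ℝ → ℝ}
    (hd : ∀ x ∈ Icc (π / 2 - α) (π / 2 + α), HasDerivAt h (h' x) x)
    (hc' : ContinuousOn h' (Icc (π / 2 - α) (π / 2 + α))) :
    2.995 ^ 2 * ∫ x in (π / 2 - α)..(π / 2 + α), (h x - h (π / 2)) ^ 2 * sin x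
      ≤ ∫ x in (π / 2 - α)..(π / 2 + α), h' x ^ 2 * sin x := by
  have hc : ContinuousOn h (Icc (π / 2 - α) (π / 2 + α)) :=
    fun x hx => (hd x hx).continuousAt.continuousWithinAt
  have hsc : ContinuousOn sin (Icc (π / 2 - α) (π / 2 + α)) := continuous_sin.continuousOn
  have s1 : Icc (π / 2 - α) (π / 2) ⊆ Icc (π / 2 - α) (π / 2 + α) := Icc_subset_Icc le_rfl (by linarith)
  have s2 : Icc (π / 2) (π / 2 + α) ⊆ Icc (π / 2 - α) (π / 2 + α) := Icc_subset_Icc (by linarith) le_rfl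
  have hpi := pi_pos
  have hs : ∀ x ∈ Icc (π / 2 - α) (π / 2 + α), 0 ≤ sin x := fun x hx =>
    le_trans (by positivity) (hv_sin_lb hα' hx)
  have L := hv_half (ω := 2.995) (c0 := π / 3) (k := h (π / 2)) (by norm_num) (by linarith)
    (fun x hx => hd x (s1 hx)) (hc'.mono s1)
    (fun x hx => by rw [abs_lt]; constructor <;> linarith [hx.1, hx.2])
    (fun x hx => hs x (s1 hx))
    (fun x hx => mul_nonpos_of_nonpos_of_nonneg
      (tan_nonpos_of_nonpos_of_neg_pi_div_two_le (by linarith [hx.1]) (by linarith [hx.2]))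
      (cos_nonneg_of_mem_Icc ⟨by linarith [hx.1], hx.2⟩))
    (mul_nonpos_of_nonpos_of_nonneg
      (tan_nonpos_of_nonpos_of_neg_pi_div_two_le (by linarith) (by linarith)) (sq_nonneg _))
    (by simp)
  have R := hv_half (ω := 2.995) (c0 := 2 * π / 3) (k := h (π / 2)) (by norm_num) (by linarith)
    (fun x hx => hd x (s2 hx)) (hc'.mono s2)
    (fun x hx => by rw [abs_lt]; constructor <;> linarith [hx.1, hx.2])
    (fun x hx => hs x (s2 hx))
    (fun x hx => mul_nonpos_of_nonneg_of_nonpos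
      (tan_nonneg_of_nonneg_of_le_pi_div_two (by linarith [hx.2]) (by linarith [hx.1]))
      (cos_nonpos_of_pi_div_two_le_of_le hx.1 (by linarith [hx.2])))
    (by simp)
    (mul_nonneg
      (tan_nonneg_of_nonneg_of_le_pi_div_two (by linarith) (by linarith)) (sq_nonneg _))
  rw [← intervalIntegral.integral_add_adjacent_intervals (b := π / 2)
      (f := fun x => (h x - h (π / 2)) ^ 2 * sin x)
      (hv_ii (by linarith) (ContinuousOn.mono (by fun_prop) s1))
      (hv_ii (by linarith) (ContinuousOn.mono (by fun_prop) s2)),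
    ← intervalIntegral.integral_add_adjacent_intervals (b := π / 2)
      (f := fun x => h' x ^ 2 * sin x)
      (hv_ii (by linarith) (ContinuousOn.mono (by fun_prop) s1))
      (hv_ii (by linarith) (ContinuousOn.mono (by fun_prop) s2))]
  linarith

lemma hv_expand {a b : ℝ} (hab : a ≤ b) {h : ℝ → ℝ} (hc : ContinuousOn h (Icc a b)) (k : ℝ) :
    ∫ x in a..b, (h x - k) ^ 2 * sin x = (∫ x in a..b, h x ^ 2 * sin x)
      - 2 * k * (∫ x in a..b, h x * sin x) + k ^ 2 * ∫ x in a..b, sin x := by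
  have hsc : ContinuousOn sin (Icc a b) := continuous_sin.continuousOn
  have i1 : IntervalIntegrable (fun x => h x ^ 2 * sin x) volume a b := hv_ii hab (by fun_prop)
  have i2 : IntervalIntegrable (fun x => h x * sin x) volume a b := hv_ii hab (by fun_prop)
  have i3 : IntervalIntegrable (fun x => sin x) volume a b := hv_ii hab (by fun_prop)
  rw [← intervalIntegral.integral_const_mul, ← intervalIntegral.integral_const_mul,
    ← intervalIntegral.integral_sub i1 (i2.const_mul _),
    ← intervalIntegral.integral_add (i1.sub (i2.const_mul _)) (i3.const_mul _)]
  congr 1; ext x; ring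

lemma hv_angular {α : ℝ} (hα : 0 < α) (hα' : α ≤ π / 6) {h h' : ℝ → ℝ}
    (hd : ∀ x ∈ Icc (π / 2 - α) (π / 2 + α), HasDerivAt h (h' x) x)
    (hc' : ContinuousOn h' (Icc (π / 2 - α) (π / 2 + α))) {S1 S2 : ℝ}
    (hS1 : S1 = ∫ x in (π / 2 - α)..(π / 2 + α), sin x)
    (hS2 : S2 = ∫ x in (π / 2 - α)..(π / 2 + α), sin x * sin x) :
    (∫ x in (π / 2 - α)..(π / 2 + α), h x ^ 2 * sin x)
      + 5 * S1 * ((∫ x in (π / 2 - α)..(π / 2 + α), h x * sin x * sin x) / S2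
        - (∫ x in (π / 2 - α)..(π / 2 + α), h x * sin x) / S1) ^ 2
      ≤ S1 * ((∫ x in (π / 2 - α)..(π / 2 + α), h x * sin x) / S1) ^ 2
        + 1 / (5 * √3) * ∫ x in (π / 2 - α)..(π / 2 + α), h' x ^ 2 * sin x := by
  have hab : π / 2 - α ≤ π / 2 + α := by linarith
  have hab' : π / 2 - α < π / 2 + α := by linarith
  have hP := hv_poincare hα hα' hd hc'
  have hlb : ∀ x ∈ Icc (π / 2 - α) (π / 2 + α), √3 / 2 ≤ sin x := fun x hx => hv_sin_lb hα' hx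
  generalize π / 2 - α = a at *
  generalize π / 2 + α = b at *
  have hc : ContinuousOn h (Icc a b) := fun x hx => (hd x hx).continuousAt.continuousWithinAt
  have hsc : ContinuousOn sin (Icc a b) := continuous_sin.continuousOn
  have q1 : (1.732 : ℝ) ≤ √3 := Real.le_sqrt_of_sq_le (by norm_num)
  have q2 : √3 ≤ 1.7321 := Real.sqrt_le_iff.2 (by norm_num)
  have qq : √3 ^ 2 = 3 := Real.sq_sqrt (by norm_num)
  have hs0 : ∀ x ∈ Icc a b, 0 ≤ sin x := fun x hx => le_trans (by positivity) (hlb x hx)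
  have i1 : IntervalIntegrable (fun x => sin x) volume a b := hv_ii hab (by fun_prop)
  have i2 : IntervalIntegrable (fun x => sin x * sin x) volume a b := hv_ii hab (by fun_prop)
  have S1pos : 0 < S1 := by
    have h1 : ∫ x in a..b, √3 / 2 ≤ ∫ x in a..b, sin x :=
      intervalIntegral.integral_mono_on hab (by simp) i1 hlb
    rw [intervalIntegral.integral_const, smul_eq_mul, ← hS1] at h1
    have : 0 < (b - a) * (√3 / 2) := mul_pos (by linarith) (by positivity)
    linarith
  have S2lb : √3 / 2 * S1 ≤ S2 := by
    rw [hS1, hS2, ← intervalIntegral.integral_const_mul]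
    exact intervalIntegral.integral_mono_on hab (i1.const_mul _) i2
      (fun x hx => mul_le_mul_of_nonneg_right (hlb x hx) (hs0 x hx))
  have S2pos : 0 < S2 := lt_of_lt_of_le (by positivity) S2lb
  rw [hv_expand hab hc, ← hS1] at hP
  set M := ∫ x in a..b, h x ^ 2 * sin x with hM
  set N := ∫ x in a..b, h x * sin x with hN
  set P := ∫ x in a..b, h' x ^ 2 * sin x with hPdef
  set A := ∫ x in a..b, h x * sin x * sin x with hA
  have hP0 : 0 ≤ P := intervalIntegral.integral_nonneg hab fun x hx =>
    mul_nonneg (sq_nonneg _) (hs0 x hx)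
  have cs := hv_cs (u := fun x => h x - N / S1) (v := fun x => sin x - S2 / S1) (w := sin) hab
    (by fun_prop) (by fun_prop) hsc hs0
  have i3 : IntervalIntegrable (fun x => h x * sin x) volume a b := hv_ii hab (by fun_prop)
  have i4 : IntervalIntegrable (fun x => h x * sin x * sin x) volume a b := hv_ii hab (by fun_prop)
  have eD : ∫ x in a..b, (h x - N / S1) * (sin x - S2 / S1) * sin x = A - S2 / S1 * N := by
    have : ∫ x in a..b, (h x - N / S1) * (sin x - S2 / S1) * sin x
      = ∫ x in a..b, (h x * sin x * sin x - S2 / S1 * (h x * sin x)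
        - (N / S1 * (sin x * sin x) - N / S1 * (S2 / S1) * sin x)) := by congr 1; ext x; ring
    rw [this, intervalIntegral.integral_sub (i4.sub (i3.const_mul _))
      ((i2.const_mul _).sub (i1.const_mul _)), intervalIntegral.integral_sub i4 (i3.const_mul _),
      intervalIntegral.integral_sub (i2.const_mul _) (i1.const_mul _),
      intervalIntegral.integral_const_mul, intervalIntegral.integral_const_mul,
      intervalIntegral.integral_const_mul, ← hS1, ← hS2, ← hA, ← hN]
    field_simp; ring
  rw [eD, hv_expand hab hc, hv_expand hab hsc, ← hS1, ← hM, ← hN, ← hS2] at cs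
  have hT0 : ∫ x in a..b, (sin x - (1 + √3 / 2) / 2) ^ 2 * sin x
      ≤ ((1 - √3 / 2) / 2) ^ 2 * S1 := by
    rw [hS1, ← intervalIntegral.integral_const_mul]
    refine intervalIntegral.integral_mono_on hab (hv_ii hab (by fun_prop)) (i1.const_mul _) ?_
    intro x hx
    refine mul_le_mul_of_nonneg_right ?_ (hs0 x hx)
    nlinarith [hlb x hx, sin_le_one x]
  rw [hv_expand hab hsc, ← hS1, ← hS2] at hT0
  generalize (∫ x in a..b, sin x ^ 2 * sin x) = T at *
  have hr : ((1 - √3 / 2) / 2) ^ 2 ≤ 0.004489 := by nlinarith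
  obtain ⟨g, hg⟩ : ∃ g, g = N / S1 := ⟨_, rfl⟩
  obtain ⟨c, hcc⟩ : ∃ c, c = S2 / S1 := ⟨_, rfl⟩
  have hN' : N = S1 * g := by rw [hg]; field_simp
  have hS2' : S2 = c * S1 := by rw [hcc]; field_simp
  rw [← hg, ← hcc, hN', hS2'] at cs
  rw [hN'] at hP
  rw [← hg]
  rw [hS2'] at hT0 S2lb
  have c_lb : √3 / 2 ≤ c := le_of_mul_le_mul_right S2lb S1pos
  have c_sq : 3 / 4 ≤ c ^ 2 := by nlinarith
  obtain ⟨W, hW⟩ : ∃ W, W = M - S1 * g ^ 2 := ⟨_, rfl⟩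
  have hWP : 2.995 ^ 2 * W ≤ P := by
    have : 0 ≤ S1 * (g - h (π / 2)) ^ 2 := by positivity
    rw [hW]; linarith
  have hW0 : 0 ≤ W := by
    have : 0 ≤ ∫ x in a..b, (h x - g) ^ 2 * sin x := intervalIntegral.integral_nonneg hab fun x hx =>
      mul_nonneg (sq_nonneg _) (hs0 x hx)
    rw [hv_expand hab hc, ← hS1, ← hM, ← hN, hN'] at this
    rw [hW]; linarith
  have hT : T - c ^ 2 * S1 ≤ 0.004489 * S1 := by
    have : 0 ≤ S1 * (c - (1 + √3 / 2) / 2) ^ 2 := by positivity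
    have := mul_le_mul_of_nonneg_right hr S1pos.le
    linarith
  have cs' : (A - c * (S1 * g)) ^ 2 ≤ W * (0.004489 * S1) := by
    refine le_trans cs ?_
    have e1 : M - 2 * g * (S1 * g) + g ^ 2 * S1 = W := by rw [hW]; ring
    rw [e1]
    refine mul_le_mul_of_nonneg_left ?_ hW0
    linarith
  have he : S1 * (A / S2 - g) ^ 2 ≤ 0.006 * W := by
    have e1 : S1 * (A / S2 - g) ^ 2 = (A - c * (S1 * g)) ^ 2 / (c ^ 2 * S1) := by
      rw [hS2']
      have : c ≠ 0 := by rintro rfl; norm_num at c_sq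
      field_simp
    rw [e1, div_le_iff₀ (by positivity)]
    have h0 : 0 ≤ W * S1 := by positivity
    have h1 := mul_le_mul_of_nonneg_right c_sq h0
    have h2 : 0.006 * W * (c ^ 2 * S1) = 0.006 * (c ^ 2 * (W * S1)) := by ring
    have h3 : W * (0.004489 * S1) = 0.004489 * (W * S1) := by ring
    rw [h2]
    rw [h3] at cs'
    linarith
  have hC : 0.11546 ≤ 1 / (5 * √3) := by
    rw [le_div_iff₀ (by positivity)]; linarith
  have := mul_le_mul_of_nonneg_right hC hP0
  have : M = W + S1 * g ^ 2 := by rw [hW]; ring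
  linarith

lemma hv_core {ε : ℝ} (he0 : 0 < ε) (he1 : ε ≤ 1 / 1000) (n : ℕ) (hn : n = 3 ∨ n = 4)
    {α : ℝ} (hα : 0 < α) (hα' : α ≤ π / 6) {f fr fp : ℝ → ℝ → ℝ}
    (hcf : ContinuousOn (fun p : ℝ × ℝ => f p.1 p.2) (Icc ε 1 ×ˢ Icc (π / 2 - α) (π / 2 + α)))
    (hcr : ContinuousOn (fun p : ℝ × ℝ => fr p.1 p.2) (Icc ε 1 ×ˢ Icc (π / 2 - α) (π / 2 + α)))
    (hcp : ContinuousOn (fun p : ℝ × ℝ => fp p.1 p.2) (Icc ε 1 ×ˢ Icc (π / 2 - α) (π / 2 + α)))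
    (hdr : ∀ ρ ∈ Icc ε 1, ∀ φ ∈ Icc (π / 2 - α) (π / 2 + α),
      HasDerivAt (fun s => f s φ) (fr ρ φ) ρ)
    (hdp : ∀ ρ ∈ Icc ε 1, ∀ φ ∈ Icc (π / 2 - α) (π / 2 + α),
      HasDerivAt (fun t => f ρ t) (fp ρ φ) φ)
    (hmean : (∫ ρ in ε..1, ρ ^ n * ∫ φ in (π / 2 - α)..(π / 2 + α), f ρ φ * sin φ * sin φ) = 0) :
    (∫ ρ in ε..1, ∫ φ in (π / 2 - α)..(π / 2 + α), f ρ φ ^ 2 * sin φ)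
      ≤ (8 / √3) * (∫ ρ in ε..1, ρ ^ 2 * ∫ φ in (π / 2 - α)..(π / 2 + α), fr ρ φ ^ 2 * sin φ)
        + (1 / (5 * √3)) * ∫ ρ in ε..1, ∫ φ in (π / 2 - α)..(π / 2 + α), fp ρ φ ^ 2 * sin φ := by
  have hε1 : ε ≤ 1 := by linarith
  have hab : π / 2 - α ≤ π / 2 + α := by linarith
  have ang := fun ρ (hρ : ρ ∈ Icc ε 1) => hv_angular hα hα' (h := f ρ) (h' := fp ρ) (hdp ρ hρ)
    (hv_slice hcp hρ) rfl rfl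
  have hlb : ∀ x ∈ Icc (π / 2 - α) (π / 2 + α), √3 / 2 ≤ sin x := fun x hx => hv_sin_lb hα' hx
  have hab' : π / 2 - α < π / 2 + α := by linarith
  generalize π / 2 - α = a at *
  generalize π / 2 + α = b at *
  have hs0 : ∀ x ∈ Icc a b, 0 ≤ sin x := fun x hx => le_trans (by positivity) (hlb x hx)
  have hsc : ContinuousOn sin (Icc a b) := continuous_sin.continuousOn
  have hs2 : ContinuousOn (fun p : ℝ × ℝ => sin p.2) (Icc ε 1 ×ˢ Icc a b) :=
    (continuous_sin.comp continuous_snd).continuousOn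
  have i1 : IntervalIntegrable (fun x => sin x) volume a b := hv_ii hab (by fun_prop)
  have i2 : IntervalIntegrable (fun x => sin x * sin x) volume a b := hv_ii hab (by fun_prop)
  obtain ⟨S1, hS1⟩ : ∃ S, S = ∫ x in a..b, sin x := ⟨_, rfl⟩
  obtain ⟨S2, hS2⟩ : ∃ S, S = ∫ x in a..b, sin x * sin x := ⟨_, rfl⟩
  simp only [← hS1, ← hS2] at ang
  have S1pos : 0 < S1 := by
    have h1 : ∫ x in a..b, √3 / 2 ≤ ∫ x in a..b, sin x :=
      intervalIntegral.integral_mono_on hab (by simp) i1 hlb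
    rw [intervalIntegral.integral_const, smul_eq_mul, ← hS1] at h1
    have : 0 < (b - a) * (√3 / 2) := mul_pos (by linarith) (by positivity)
    linarith
  have cM : ContinuousOn (fun ρ => ∫ φ in a..b, f ρ φ ^ 2 * sin φ) (Icc ε 1) :=
    hv_param_cont hε1 hab ((hcf.pow 2).mul hs2)
  have cV : ContinuousOn (fun ρ => ∫ φ in a..b, fr ρ φ ^ 2 * sin φ) (Icc ε 1) :=
    hv_param_cont hε1 hab ((hcr.pow 2).mul hs2)
  have cP : ContinuousOn (fun ρ => ∫ φ in a..b, fp ρ φ ^ 2 * sin φ) (Icc ε 1) :=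
    hv_param_cont hε1 hab ((hcp.pow 2).mul hs2)
  have cN : ContinuousOn (fun ρ => ∫ φ in a..b, f ρ φ * sin φ) (Icc ε 1) :=
    hv_param_cont hε1 hab (hcf.mul hs2)
  have cN' : ContinuousOn (fun ρ => ∫ φ in a..b, fr ρ φ * sin φ) (Icc ε 1) :=
    hv_param_cont hε1 hab (hcr.mul hs2)
  have cA : ContinuousOn (fun ρ => ∫ φ in a..b, f ρ φ * sin φ * sin φ) (Icc ε 1) :=
    hv_param_cont hε1 hab ((hcf.mul hs2).mul hs2)
  have hN : ∀ x ∈ Ioo ε 1, HasDerivAt (fun ρ => ∫ φ in a..b, f ρ φ * sin φ)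
      (∫ φ in a..b, fr x φ * sin φ) x := fun x hx =>
    hv_param_deriv (F := fun ρ φ => f ρ φ * sin φ) (F' := fun ρ φ => fr ρ φ * sin φ) hab
      (hcf.mul hs2) (hcr.mul hs2) (fun s hs y hy => (hdr s hs y hy).mul_const _) hx
  have hV : ∀ ρ ∈ Icc ε 1, (∫ φ in a..b, fr ρ φ * sin φ) ^ 2
      ≤ (∫ φ in a..b, fr ρ φ ^ 2 * sin φ) * S1 := by
    intro ρ hρ
    have := hv_cs (u := fr ρ) (v := fun _ => 1) hab (hv_slice hcr hρ) continuousOn_const hsc hs0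
    simpa [← hS1] using this
  have hV0 : ∀ ρ ∈ Icc ε 1, 0 ≤ ∫ φ in a..b, fr ρ φ ^ 2 * sin φ := fun ρ hρ =>
    intervalIntegral.integral_nonneg hab fun x hx => mul_nonneg (sq_nonneg _) (hs0 x hx)
  generalize hMM : (fun ρ => ∫ φ in a..b, f ρ φ ^ 2 * sin φ) = M at *
  generalize hVV : (fun ρ => ∫ φ in a..b, fr ρ φ ^ 2 * sin φ) = V at *
  generalize hPP : (fun ρ => ∫ φ in a..b, fp ρ φ ^ 2 * sin φ) = P at *
  generalize hNN : (fun ρ => ∫ φ in a..b, f ρ φ * sin φ) = N at *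
  generalize hNN' : (fun ρ => ∫ φ in a..b, fr ρ φ * sin φ) = N' at *
  generalize hAA : (fun ρ => ∫ φ in a..b, f ρ φ * sin φ * sin φ) = A at *
  simp only [funext_iff] at hMM hVV hPP hNN hNN' hAA
  simp only [hMM, hVV, hPP, hNN, hNN', hAA] at *
  have one := hv_oneD he0 he1 n hn (g := fun ρ => N ρ / S1) (g' := fun ρ => N' ρ / S1)
    (e := fun ρ => A ρ / S2 - N ρ / S1) (by fun_prop) (by fun_prop) (by fun_prop)
    (fun x hx => (hN x hx).div_const _) (by
      have : (fun x => x ^ n * (N x / S1 + (A x / S2 - N x / S1)))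
        = fun x => (1 / S2) * (x ^ n * A x) := by ext x; ring
      rw [this, intervalIntegral.integral_const_mul, hmean, mul_zero])
  have k1 : ∫ ρ in ε..1, (M ρ + 5 * S1 * (A ρ / S2 - N ρ / S1) ^ 2)
      ≤ ∫ ρ in ε..1, (S1 * (N ρ / S1) ^ 2 + 1 / (5 * √3) * P ρ) :=
    intervalIntegral.integral_mono_on hε1 (hv_ii hε1 (by fun_prop)) (hv_ii hε1 (by fun_prop)) ang
  rw [intervalIntegral.integral_add (hv_ii hε1 (by fun_prop)) (hv_ii hε1 (by fun_prop)),
    intervalIntegral.integral_add (hv_ii hε1 (by fun_prop)) (hv_ii hε1 (by fun_prop)),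
    intervalIntegral.integral_const_mul, intervalIntegral.integral_const_mul,
    intervalIntegral.integral_const_mul] at k1
  have k2 : S1 * ∫ ρ in ε..1, ρ ^ 2 * (N' ρ / S1) ^ 2 ≤ ∫ ρ in ε..1, ρ ^ 2 * V ρ := by
    rw [← intervalIntegral.integral_const_mul]
    refine intervalIntegral.integral_mono_on hε1 (hv_ii hε1 (by fun_prop)) (hv_ii hε1 (by fun_prop)) ?_
    intro ρ hρ
    have e1 : S1 * (ρ ^ 2 * (N' ρ / S1) ^ 2) = ρ ^ 2 * (N' ρ ^ 2 / S1) := by field_simp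
    rw [e1]
    refine mul_le_mul_of_nonneg_left ?_ (sq_nonneg _)
    rw [div_le_iff₀ S1pos]
    exact hV ρ hρ
  have k3 : 0 ≤ ∫ ρ in ε..1, ρ ^ 2 * V ρ := intervalIntegral.integral_nonneg hε1 fun x hx =>
    mul_nonneg (sq_nonneg _) (hV0 x hx)
  have hC : 4 ≤ 8 / √3 := by
    rw [le_div_iff₀ (by positivity)]
    have q2 : √3 ≤ 1.7321 := Real.sqrt_le_iff.2 (by norm_num)
    linarith
  have k4 := mul_le_mul_of_nonneg_right hC k3
  have k5 := mul_le_mul_of_nonneg_left one S1pos.le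
  linarith

lemma hv_congr {ε a b K : ℝ} (he : 0 < ε) (he1 : ε ≤ 1) {F : ℝ → ℝ → ℝ} {G : ℝ → ℝ}
    (h : ∀ ρ, 0 < ρ → ∫ φ in a..b, F ρ φ = K * G ρ) :
    ∫ ρ in ε..1, ∫ φ in a..b, F ρ φ = K * ∫ ρ in ε..1, G ρ := by
  rw [← intervalIntegral.integral_const_mul]
  apply intervalIntegral.integral_congr
  intro ρ hρ
  rw [uIcc_of_le he1] at hρ
  exact h ρ (lt_of_lt_of_le he hρ.1)

/-- Hardy inequality for the swirl on the truncated conical shell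
`D_m = {1/m < ρ < 1, π/2-α < φ < π/2+α}` (`dx = 2πρ² sin φ dρ dφ`): if
`∫ ρ sin φ · v_θ dx = 0`, then for `f = v_θ` and for `f = v_θ/ρ`,
`∫ f²/ρ² dx ≤ (8/√3)∫|∂_ρ f|² dx + (1/(5√3))∫|ρ⁻¹∂_φ f|² dx`. -/
theorem hardy_vtheta_Dm (m : ℕ) (hm : 1000 ≤ m) (α : ℝ) (hα : 0 < α) (hα' : α ≤ π/6)
    (v vr vp : ℝ → ℝ → ℝ)
    (hcf : ContinuousOn (fun p : ℝ × ℝ => v p.1 p.2)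
      (Set.Icc (1/(m:ℝ)) 1 ×ˢ Set.Icc (π/2 - α) (π/2 + α)))
    (hcr : ContinuousOn (fun p : ℝ × ℝ => vr p.1 p.2)
      (Set.Icc (1/(m:ℝ)) 1 ×ˢ Set.Icc (π/2 - α) (π/2 + α)))
    (hcp : ContinuousOn (fun p : ℝ × ℝ => vp p.1 p.2)
      (Set.Icc (1/(m:ℝ)) 1 ×ˢ Set.Icc (π/2 - α) (π/2 + α)))
    (hdr : ∀ ρ ∈ Set.Icc (1/(m:ℝ)) 1, ∀ φ ∈ Set.Icc (π/2 - α) (π/2 + α),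
      HasDerivAt (fun s => v s φ) (vr ρ φ) ρ)
    (hdp : ∀ ρ ∈ Set.Icc (1/(m:ℝ)) 1, ∀ φ ∈ Set.Icc (π/2 - α) (π/2 + α),
      HasDerivAt (fun t => v ρ t) (vp ρ φ) φ)
    (hmean : (∫ ρ in (1/(m:ℝ))..1, ∫ φ in (π/2 - α)..(π/2 + α),
        (ρ * Real.sin φ * v ρ φ) * (2*π*ρ^2*Real.sin φ)) = 0) :
    -- the case f = v_θ
    ((∫ ρ in (1/(m:ℝ))..1, ∫ φ in (π/2 - α)..(π/2 + α),
        (v ρ φ / ρ) ^ 2 * (2*π*ρ^2*Real.sin φ))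
      ≤ (8 / Real.sqrt 3) * (∫ ρ in (1/(m:ℝ))..1, ∫ φ in (π/2 - α)..(π/2 + α),
            vr ρ φ ^ 2 * (2*π*ρ^2*Real.sin φ))
        + (1 / (5 * Real.sqrt 3)) * (∫ ρ in (1/(m:ℝ))..1, ∫ φ in (π/2 - α)..(π/2 + α),
            (vp ρ φ / ρ) ^ 2 * (2*π*ρ^2*Real.sin φ)))
    ∧
    -- the case f = v_θ/ρ, with ∂_ρ(v/ρ) = v_ρ/ρ - v/ρ² and ∂_φ(v/ρ) = v_φ/ρ
    ((∫ ρ in (1/(m:ℝ))..1, ∫ φ in (π/2 - α)..(π/2 + α),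
        (v ρ φ / ρ^2) ^ 2 * (2*π*ρ^2*Real.sin φ))
      ≤ (8 / Real.sqrt 3) * (∫ ρ in (1/(m:ℝ))..1, ∫ φ in (π/2 - α)..(π/2 + α),
            (vr ρ φ / ρ - v ρ φ / ρ^2) ^ 2 * (2*π*ρ^2*Real.sin φ))
        + (1 / (5 * Real.sqrt 3)) * (∫ ρ in (1/(m:ℝ))..1, ∫ φ in (π/2 - α)..(π/2 + α),
            (vp ρ φ / ρ^2) ^ 2 * (2*π*ρ^2*Real.sin φ))) := by
  have hm' : (1000 : ℝ) ≤ m := by exact_mod_cast hm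
  have he0 : 0 < 1 / (m : ℝ) := by positivity
  have he1 : 1 / (m : ℝ) ≤ 1 / 1000 := one_div_le_one_div_of_le (by norm_num) hm'
  generalize 1 / (m : ℝ) = ε at *
  have hε1 : ε ≤ 1 := by linarith
  have h2pi : 0 < 2 * π := by positivity
  have hmean' : (∫ ρ in ε..1, ρ ^ 3 * ∫ φ in (π / 2 - α)..(π / 2 + α), v ρ φ * sin φ * sin φ) = 0 := by
    rw [hv_congr (K := 2 * π)
      (G := fun ρ => ρ ^ 3 * ∫ φ in (π / 2 - α)..(π / 2 + α), v ρ φ * sin φ * sin φ) he0 hε1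
      (fun ρ hρ => by
        rw [← intervalIntegral.integral_const_mul, ← intervalIntegral.integral_const_mul]
        congr 1; ext φ; ring)] at hmean
    exact (mul_eq_zero.1 hmean).resolve_left h2pi.ne'
  constructor
  · have core := hv_core he0 he1 3 (Or.inl rfl) hα hα' hcf hcr hcp hdr hdp hmean'
    rw [hv_congr (K := 2 * π) (F := fun ρ φ => (v ρ φ / ρ) ^ 2 * (2*π*ρ^2*Real.sin φ))
      (G := fun ρ => ∫ φ in (π / 2 - α)..(π / 2 + α), v ρ φ ^ 2 * sin φ) he0 hε1
      (fun ρ hρ => by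
        rw [← intervalIntegral.integral_const_mul]
        congr 1; ext φ; field_simp),
      hv_congr (K := 2 * π) (F := fun ρ φ => vr ρ φ ^ 2 * (2*π*ρ^2*Real.sin φ))
      (G := fun ρ => ρ ^ 2 * ∫ φ in (π / 2 - α)..(π / 2 + α), vr ρ φ ^ 2 * sin φ) he0 hε1
      (fun ρ hρ => by
        rw [← intervalIntegral.integral_const_mul, ← intervalIntegral.integral_const_mul]
        congr 1; ext φ; ring),
      hv_congr (K := 2 * π) (F := fun ρ φ => (vp ρ φ / ρ) ^ 2 * (2*π*ρ^2*Real.sin φ))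
      (G := fun ρ => ∫ φ in (π / 2 - α)..(π / 2 + α), vp ρ φ ^ 2 * sin φ) he0 hε1
      (fun ρ hρ => by
        rw [← intervalIntegral.integral_const_mul]
        congr 1; ext φ; field_simp)]
    have := mul_le_mul_of_nonneg_left core h2pi.le
    linarith
  · have hpos : ∀ p ∈ Icc ε 1 ×ˢ Icc (π / 2 - α) (π / 2 + α), (p : ℝ × ℝ).1 ≠ 0 := fun p hp =>
      (lt_of_lt_of_le he0 hp.1.1).ne'
    have hfst : ContinuousOn (fun p : ℝ × ℝ => p.1) (Icc ε 1 ×ˢ Icc (π / 2 - α) (π / 2 + α)) :=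
      continuous_fst.continuousOn
    have core := hv_core he0 he1 4 (Or.inr rfl) hα hα' (f := fun ρ φ => v ρ φ / ρ)
      (fr := fun ρ φ => vr ρ φ / ρ - v ρ φ / ρ ^ 2) (fp := fun ρ φ => vp ρ φ / ρ)
      (hcf.div hfst hpos)
      ((hcr.div hfst hpos).sub (hcf.div (hfst.pow 2) (fun p hp => pow_ne_zero 2 (hpos p hp))))
      (hcp.div hfst hpos)
      (fun ρ hρ φ hφ => by
        have h0 : ρ ≠ 0 := (lt_of_lt_of_le he0 hρ.1).ne'
        refine ((hdr ρ hρ φ hφ).div (hasDerivAt_id ρ) h0).congr_deriv ?_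
        simp only [id]
        field_simp)
      (fun ρ hρ φ hφ => (hdp ρ hρ φ hφ).div_const _)
      (by
        rw [← hmean']
        apply intervalIntegral.integral_congr
        intro ρ hρ
        rw [uIcc_of_le hε1] at hρ
        have h0 : ρ ≠ 0 := (lt_of_lt_of_le he0 hρ.1).ne'
        simp only
        rw [← intervalIntegral.integral_const_mul, ← intervalIntegral.integral_const_mul]
        congr 1; ext φ; field_simp)
    rw [hv_congr (K := 2 * π) (F := fun ρ φ => (v ρ φ / ρ^2) ^ 2 * (2*π*ρ^2*Real.sin φ))
      (G := fun ρ => ∫ φ in (π / 2 - α)..(π / 2 + α), (v ρ φ / ρ) ^ 2 * sin φ) he0 hε1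
      (fun ρ hρ => by
        rw [← intervalIntegral.integral_const_mul]
        congr 1; ext φ; field_simp),
      hv_congr (K := 2 * π) (F := fun ρ φ => (vr ρ φ / ρ - v ρ φ / ρ^2) ^ 2 * (2*π*ρ^2*Real.sin φ))
      (G := fun ρ => ρ ^ 2 * ∫ φ in (π / 2 - α)..(π / 2 + α),
        (vr ρ φ / ρ - v ρ φ / ρ ^ 2) ^ 2 * sin φ) he0 hε1
      (fun ρ hρ => by
        rw [← intervalIntegral.integral_const_mul, ← intervalIntegral.integral_const_mul]
        congr 1; ext φ; ring),
      hv_congr (K := 2 * π) (F := fun ρ φ => (vp ρ φ / ρ^2) ^ 2 * (2*π*ρ^2*Real.sin φ))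
      (G := fun ρ => ∫ φ in (π / 2 - α)..(π / 2 + α), (vp ρ φ / ρ) ^ 2 * sin φ) he0 hε1
      (fun ρ hρ => by
        rw [← intervalIntegral.integral_const_mul]
        congr 1; ext φ; field_simp)]
    have := mul_le_mul_of_nonneg_left core h2pi.le
    linarith
end

section
/- Let m ≥ 1000 and 0 < α ≤ π/6, and let g ∈ H¹(D_m) with ∫_{D_m} ρ² sin φ · g dx = 0 (i.e. g = v_θ/ρ where ∫ ρ sin φ v_θ dx = 0). Then |∫_{D_m} cot φ · (ρ⁻¹∂_φ g)(g/ρ) dx| ≤ 0.7 ∫_{D_m}|∇g|² dx, where |∇g|² = |∂_ρ g|² + |ρ⁻¹∂_φ g|². -/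
open MeasureTheory Real Set

lemma cs_aux (a : ℝ) (ha : a ≤ 1) (f h : ℝ → ℝ)
    (hf : ContinuousOn f (Icc a 1)) (hh : ContinuousOn h (Icc a 1))
    (hF : ∫ x in a..1, f x ^ 2 ≤ 1/9) :
    (∫ x in a..1, f x * h x)^2 ≤ (1/9) * ∫ x in a..1, h x ^ 2 := by
  have e : uIcc a 1 = Icc a 1 := uIcc_of_le ha
  set I := ∫ x in a..1, f x * h x with hI
  have i1 : IntervalIntegrable (fun x => h x ^ 2) volume a 1 :=
    ContinuousOn.intervalIntegrable (by rw [e]; fun_prop)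
  have i2 : IntervalIntegrable (fun x => f x * h x) volume a 1 :=
    ContinuousOn.intervalIntegrable (by rw [e]; fun_prop)
  have i3 : IntervalIntegrable (fun x => f x ^ 2) volume a 1 :=
    ContinuousOn.intervalIntegrable (by rw [e]; fun_prop)
  have h0 : 0 ≤ ∫ x in a..1, (h x - 9 * I * f x)^2 :=
    intervalIntegral.integral_nonneg ha (fun x _ => sq_nonneg _)
  have h1 : ∫ x in a..1, (h x - 9 * I * f x)^2 =
      (∫ x in a..1, h x ^ 2) - 18 * I * I + 81 * I^2 * ∫ x in a..1, f x ^ 2 := by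
    have : ∀ x, (h x - 9 * I * f x)^2 = h x ^ 2 - (18 * I) * (f x * h x) + (81 * I^2) * f x ^ 2 := by
      intro x; ring
    simp_rw [this]
    rw [intervalIntegral.integral_add (i1.sub (i2.const_mul _)) (i3.const_mul _),
      intervalIntegral.integral_sub i1 (i2.const_mul _),
      intervalIntegral.integral_const_mul, intervalIntegral.integral_const_mul]
  nlinarith [sq_nonneg I, mul_le_mul_of_nonneg_left hF (sq_nonneg I)]

lemma pow8_aux (a : ℝ) (ha0 : 0 < a) : ∫ x in a..1, x^8 ≤ (1/9 : ℝ) := by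
  rw [integral_pow]
  have : 0 < a^9 := by positivity
  norm_num
  linarith

/-- One-dimensional Hardy inequality. -/
lemma hardy_aux (a : ℝ) (ha0 : 0 < a) (ha : a ≤ 1/2) (u u' : ℝ → ℝ)
    (hu : ContinuousOn u (Icc a 1)) (hu' : ContinuousOn u' (Icc a 1))
    (hd : ∀ x ∈ Ioo a 1, HasDerivAt u (u' x) x) :
    ∫ x in a..1, u x ^ 2 ≤ (130/27) * (∫ x in a..1, x^2 * u' x ^ 2)
      + (175/3) * (∫ x in a..1, x^4 * u x)^2 := by
  have ha1 : a ≤ 1 := by linarith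
  have e : uIcc a 1 = Icc a 1 := uIcc_of_le ha1
  have i1 : IntervalIntegrable (fun x => u x ^ 2) volume a 1 :=
    ContinuousOn.intervalIntegrable (by rw [e]; fun_prop)
  have i2 : IntervalIntegrable (fun x => x^2 * u' x ^ 2) volume a 1 :=
    ContinuousOn.intervalIntegrable (by rw [e]; fun_prop)
  have i3 : IntervalIntegrable (fun x => (x - a) * u x * u' x) volume a 1 :=
    ContinuousOn.intervalIntegrable (by rw [e]; fun_prop)
  have i4 : IntervalIntegrable (fun x => x^4 * u x) volume a 1 :=
    ContinuousOn.intervalIntegrable (by rw [e]; fun_prop)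
  have i5 : IntervalIntegrable (fun x => (x^5 - a^5) * u' x) volume a 1 :=
    ContinuousOn.intervalIntegrable (by rw [e]; fun_prop)
  set X := ∫ x in a..1, u x ^ 2 with hX
  set A := ∫ x in a..1, x^2 * u' x ^ 2 with hA
  set c := ∫ x in a..1, x^4 * u x with hc
  set J := ∫ x in a..1, (x^5 - a^5) * u' x with hJ
  -- first integration by parts
  have p1 : X + 2 * ∫ x in a..1, (x - a) * u x * u' x = (1 - a) * u 1 ^ 2 := by
    have := intervalIntegral.integral_eq_sub_of_hasDerivAt_of_le (a := a) (b := 1)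
      (f := fun x => (x - a) * u x ^ 2)
      (f' := fun x => u x ^ 2 + 2 * ((x - a) * u x * u' x)) ha1 (by fun_prop)
      (fun x hx => by
        have h := ((hasDerivAt_id x).sub_const a).mul ((hd x hx).pow 2)
        refine h.congr_deriv ?_
        simp; ring)
      (i1.add (i3.const_mul 2))
    rw [intervalIntegral.integral_add i1 (i3.const_mul 2), intervalIntegral.integral_const_mul] at this
    rw [this]; ring
  have p2 : 5 * c + J = (1 - a^5) * u 1 := by
    have := intervalIntegral.integral_eq_sub_of_hasDerivAt_of_le (a := a) (b := 1)
      (f := fun x => (x^5 - a^5) * u x)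
      (f' := fun x => 5 * (x^4 * u x) + (x^5 - a^5) * u' x) ha1 (by fun_prop)
      (fun x hx => by
        have h := ((hasDerivAt_pow 5 x).sub_const (a^5)).mul (hd x hx)
        refine h.congr_deriv ?_
        simp; ring)
      ((i4.const_mul 5).add i5)
    rw [intervalIntegral.integral_add (i4.const_mul 5) i5, intervalIntegral.integral_const_mul] at this
    rw [this]; ring
  have p3 : J^2 ≤ (1/9) * A := by
    have h1 : ContinuousOn (fun x : ℝ => (x^5 - a^5)/x) (Icc a 1) := by
      apply ContinuousOn.div (by fun_prop) (by fun_prop)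
      intro x hx; have := hx.1; linarith
    have h := cs_aux a ha1 (fun x => (x^5 - a^5)/x) (fun x => x * u' x) h1 (by fun_prop) ?_
    · have e1 : ∫ x in a..1, (fun x => (x^5 - a^5)/x) x * (fun x => x * u' x) x = J := by
        apply intervalIntegral.integral_congr
        intro x hx
        rw [e] at hx
        have : 0 < x := by linarith [hx.1]
        simp only; field_simp
      have e2 : ∫ x in a..1, (fun x => x * u' x) x ^ 2 = A := by
        apply intervalIntegral.integral_congr
        intro x hx
        simp only; ring
      rw [e1, e2] at h
      exact h
    · refine le_trans ?_ (pow8_aux a ha0)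
      apply intervalIntegral.integral_mono_on ha1
      · exact ContinuousOn.intervalIntegrable (by rw [e]; exact h1.pow 2)
      · exact Continuous.intervalIntegrable (by fun_prop) _ _
      · intro x hx
        have hx0 : 0 < x := by linarith [hx.1]
        have h5 : a^5 ≤ x^5 := pow_le_pow_left₀ ha0.le hx.1 5
        have : 0 < a^5 := by positivity
        have h6 : (x^5 - a^5)/x ≤ x^4 := by
          rw [div_le_iff₀ hx0]; nlinarith
        have h7 : 0 ≤ (x^5 - a^5)/x := div_nonneg (by linarith) hx0.le
        calc ((x^5 - a^5)/x)^2 ≤ (x^4)^2 := pow_le_pow_left₀ h7 h6 2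
          _ = x^8 := by ring
  have p4 : -2 * (∫ x in a..1, (x - a) * u x * u' x) ≤ (2/5) * X + (5/2) * A := by
    rw [hX, hA, ← intervalIntegral.integral_const_mul, ← intervalIntegral.integral_const_mul,
      ← intervalIntegral.integral_const_mul,
      ← intervalIntegral.integral_add (i1.const_mul _) (i2.const_mul _)]
    apply intervalIntegral.integral_mono_on ha1 (i3.const_mul _) ((i1.const_mul _).add (i2.const_mul _))
    intro x hx
    have h1 : (x - a)^2 ≤ x^2 := pow_le_pow_left₀ (by linarith [hx.1]) (by linarith) 2
    nlinarith [sq_nonneg (2 * u x + 5 * ((x-a) * u' x)), mul_le_mul_of_nonneg_right h1 (sq_nonneg (u' x))]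
  have p5 : (1 - a) * u 1 ^ 2 ≤ ((1 - a^5) * u 1)^2 := by
    have h1 : a^5 ≤ a * (1/16) := by
      have : a^4 ≤ (1/2)^4 := pow_le_pow_left₀ ha0.le ha 4
      nlinarith
    have : 1 - a ≤ (1 - a^5)^2 := by nlinarith [sq_nonneg (a^5)]
    rw [mul_pow]
    exact mul_le_mul_of_nonneg_right this (sq_nonneg _)
  rw [← p2] at p5
  nlinarith [sq_nonneg (2.5 * J - 5 * c)]

/-- One-sided Poincaré inequality. -/
lemma poincare_half (α : ℝ) (hα : 0 < α) (hα' : α ≤ π/6) (u u' : ℝ → ℝ)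
    (hu : ContinuousOn u (Icc 0 α)) (hu' : ContinuousOn u' (Icc 0 α))
    (hd : ∀ x ∈ Ioo 0 α, HasDerivAt u (u' x) x) (h0 : u 0 = 0) :
    2.94^2 * ∫ x in 0..α, u x ^ 2 * cos x ≤ ∫ x in 0..α, u' x ^ 2 * cos x := by
  have e : uIcc 0 α = Icc 0 α := uIcc_of_le hα.le
  have hpi := pi_pos
  have hy : ∀ x ∈ Icc 0 α, 0 < 2.94 * x + π/100 ∧ 2.94 * x + π/100 ≤ π/2 := by
    intro x hx
    constructor
    · have := hx.1; positivity
    · have := hx.2; linarith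
  have hs : ∀ x ∈ Icc 0 α, 0 < sin (2.94 * x + π/100) := fun x hx =>
    sin_pos_of_pos_of_lt_pi (hy x hx).1 (by linarith [(hy x hx).2])
  have hc : ∀ x ∈ Icc 0 α, 0 ≤ cos (2.94 * x + π/100) := fun x hx =>
    cos_nonneg_of_mem_Icc ⟨by linarith [(hy x hx).1], (hy x hx).2⟩
  have hcx : ∀ x ∈ Icc 0 α, 0 ≤ cos x := fun x hx =>
    cos_nonneg_of_mem_Icc ⟨by linarith [hx.1], by linarith [hx.2]⟩
  have hsx : ∀ x ∈ Icc 0 α, 0 ≤ sin x := fun x hx =>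
    sin_nonneg_of_mem_Icc ⟨by linarith [hx.1], by linarith [hx.2]⟩
  set f : ℝ → ℝ := fun x => 2.94 * (cos (2.94 * x + π/100) / sin (2.94 * x + π/100)) with hf
  have hf0 : ∀ x ∈ Icc 0 α, 0 ≤ f x := fun x hx =>
    mul_nonneg (by norm_num) (div_nonneg (hc x hx) (hs x hx).le)
  have hfc : ContinuousOn f (Icc 0 α) := by
    apply ContinuousOn.mul (by fun_prop)
    apply ContinuousOn.div (by fun_prop) (by fun_prop)
    intro x hx; exact (hs x hx).ne'
  have hfd : ∀ x ∈ Icc 0 α, HasDerivAt f (-(2.94^2) - f x ^ 2) x := by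
    intro x hx
    have hl : HasDerivAt (fun x : ℝ => 2.94 * x + π/100) 2.94 x := by
      simpa using ((hasDerivAt_id x).const_mul (2.94:ℝ)).add_const (π/100)
    have h := ((hl.cos).div (hl.sin) (hs x hx).ne').const_mul (2.94:ℝ)
    refine h.congr_deriv ?_
    have := (hs x hx).ne'
    simp only [hf]
    generalize sin (2.94 * x + π/100) = S at this ⊢
    generalize cos (2.94 * x + π/100) = C
    field_simp
  set F' : ℝ → ℝ := fun x => (-(2.94^2) - f x ^ 2) * cos x * u x ^ 2
    - f x * sin x * u x ^ 2 + 2 * f x * cos x * u x * u' x with hF'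
  have iF : IntervalIntegrable F' volume 0 α :=
    ContinuousOn.intervalIntegrable (by rw [e]; fun_prop)
  have p : ∫ x in 0..α, F' x = f α * cos α * u α ^ 2 := by
    rw [intervalIntegral.integral_eq_sub_of_hasDerivAt_of_le (f := fun x => f x * cos x * u x ^ 2)
      hα.le (by fun_prop) (fun x hx => ?_) iF]
    · simp [h0]
    · have h := ((hfd x (Ioo_subset_Icc_self hx)).mul (hasDerivAt_cos x)).mul ((hd x hx).pow 2)
      refine h.congr_deriv ?_
      simp [hF']; ring
  have hp : 0 ≤ ∫ x in 0..α, F' x := by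
    rw [p]
    have m : α ∈ Icc 0 α := ⟨hα.le, le_refl _⟩
    exact mul_nonneg (mul_nonneg (hf0 _ m) (hcx _ m)) (sq_nonneg _)
  have i1 : IntervalIntegrable (fun x => u x ^ 2 * cos x) volume 0 α :=
    ContinuousOn.intervalIntegrable (by rw [e]; fun_prop)
  have i2 : IntervalIntegrable (fun x => u' x ^ 2 * cos x) volume 0 α :=
    ContinuousOn.intervalIntegrable (by rw [e]; fun_prop)
  have q : ∫ x in 0..α, (2.94^2 * (u x ^ 2 * cos x) + F' x) ≤ ∫ x in 0..α, u' x ^ 2 * cos x := by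
    apply intervalIntegral.integral_mono_on hα.le ((i1.const_mul _).add iF) i2
    intro x hx
    have h1 := mul_nonneg (hcx x hx) (sq_nonneg (u' x - f x * u x))
    have h2 := mul_nonneg (mul_nonneg (hf0 x hx) (hsx x hx)) (sq_nonneg (u x))
    simp only [hF']
    linarith
  rw [intervalIntegral.integral_add (i1.const_mul _) iF, intervalIntegral.integral_const_mul] at q
  linarith

lemma poincare_aux (α : ℝ) (hα : 0 < α) (hα' : α ≤ π/6) (h h' : ℝ → ℝ)
    (hu : ContinuousOn h (Icc (π/2 - α) (π/2 + α)))
    (hu' : ContinuousOn h' (Icc (π/2 - α) (π/2 + α)))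
    (hd : ∀ x ∈ Ioo (π/2 - α) (π/2 + α), HasDerivAt h (h' x) x) :
    2.94^2 * ∫ x in (π/2 - α)..(π/2 + α), (h x - h (π/2)) ^ 2 * sin x
      ≤ ∫ x in (π/2 - α)..(π/2 + α), h' x ^ 2 * sin x := by
  have mr : MapsTo (fun x => π/2 + x) (Icc 0 α) (Icc (π/2 - α) (π/2 + α)) := fun x hx =>
    ⟨by simp only; linarith [hx.1], by simp only; linarith [hx.2]⟩
  have ml : MapsTo (fun x => π/2 - x) (Icc 0 α) (Icc (π/2 - α) (π/2 + α)) := fun x hx =>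
    ⟨by simp only; linarith [hx.2], by simp only; linarith [hx.1]⟩
  have hr := poincare_half α hα hα' (fun x => h (π/2 + x) - h (π/2)) (fun x => h' (π/2 + x))
    ((hu.comp (by fun_prop) mr).sub continuousOn_const) (hu'.comp (by fun_prop) mr)
    (fun x hx => by
      have := hd (π/2 + x) ⟨by linarith [hx.1], by linarith [hx.2]⟩
      simpa using (this.comp_const_add (π/2) x).sub_const (h (π/2))) (by simp)
  have hl := poincare_half α hα hα' (fun x => h (π/2 - x) - h (π/2)) (fun x => - h' (π/2 - x))
    ((hu.comp (by fun_prop) ml).sub continuousOn_const) ((hu'.comp (by fun_prop) ml).neg)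
    (fun x hx => by
      have := hd (π/2 - x) ⟨by linarith [hx.2], by linarith [hx.1]⟩
      simpa using (this.comp_const_sub (π/2) x).sub_const (h (π/2))) (by simp)
  have key : ∀ F : ℝ → ℝ, ContinuousOn F (Icc (π/2 - α) (π/2 + α)) →
      ∫ x in (π/2 - α)..(π/2 + α), F x = (∫ x in 0..α, F (π/2 - x)) + ∫ x in 0..α, F (π/2 + x) := by
    intro F hF
    rw [intervalIntegral.integral_comp_sub_left, intervalIntegral.integral_comp_add_left]
    simp only [sub_zero, add_zero]
    rw [intervalIntegral.integral_add_adjacent_intervals]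
    · apply ContinuousOn.intervalIntegrable
      rw [uIcc_of_le (by linarith)]
      exact hF.mono (Icc_subset_Icc le_rfl (by linarith))
    · apply ContinuousOn.intervalIntegrable
      rw [uIcc_of_le (by linarith)]
      exact hF.mono (Icc_subset_Icc (by linarith) le_rfl)
  rw [key _ (by fun_prop), key _ (by fun_prop)]
  have s1 : ∀ x, sin (π/2 + x) = cos x := fun x => by rw [add_comm, sin_add_pi_div_two]
  simp only [sin_pi_div_two_sub, s1]
  simp only [neg_sq] at hl
  linarith

lemma swap_aux (F : ℝ → ℝ → ℝ) (hF : Continuous (fun p : ℝ × ℝ => F p.1 p.2)) (a b c d : ℝ) :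
    ∫ x in a..b, ∫ y in c..d, F x y = ∫ y in c..d, ∫ x in a..b, F x y := by
  apply MeasureTheory.intervalIntegral_intervalIntegral_swap
  apply IntegrableOn.mono_set (t := uIcc a b ×ˢ uIcc c d)
  · exact hF.continuousOn.integrableOn_compact (isCompact_uIcc.prod isCompact_uIcc)
  · exact prod_mono uIoc_subset_uIcc uIoc_subset_uIcc

lemma cont_x (F : ℝ → ℝ → ℝ) (hF : Continuous (fun p : ℝ × ℝ => F p.1 p.2)) (c d : ℝ) :
    Continuous (fun x => ∫ y in c..d, F x y) :=
  intervalIntegral.continuous_parametric_intervalIntegral_of_continuous' hF c d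

lemma cont_y (F : ℝ → ℝ → ℝ) (hF : Continuous (fun p : ℝ × ℝ => F p.1 p.2)) (a b : ℝ) :
    Continuous (fun y => ∫ x in a..b, F x y) :=
  intervalIntegral.continuous_parametric_intervalIntegral_of_continuous' (f := fun y x => F x y)
    (hF.comp continuous_swap) a b

lemma dmono (F G : ℝ → ℝ → ℝ) (hF : Continuous (fun p : ℝ × ℝ => F p.1 p.2))
    (hG : Continuous (fun p : ℝ × ℝ => G p.1 p.2)) (a b c d : ℝ) (hab : a ≤ b) (hcd : c ≤ d)
    (h : ∀ x ∈ Icc a b, ∀ y ∈ Icc c d, F x y ≤ G x y) :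
    ∫ x in a..b, ∫ y in c..d, F x y ≤ ∫ x in a..b, ∫ y in c..d, G x y := by
  apply intervalIntegral.integral_mono_on hab
    ((cont_x F hF c d).intervalIntegrable _ _) ((cont_x G hG c d).intervalIntegrable _ _)
  intro x hx
  apply intervalIntegral.integral_mono_on hcd
    (Continuous.intervalIntegrable (hF.comp (by fun_prop : Continuous (fun y : ℝ => (x, y)))) _ _)
    (Continuous.intervalIntegrable (hG.comp (by fun_prop : Continuous (fun y : ℝ => (x, y)))) _ _)
  exact h x hx

lemma dlin (F G : ℝ → ℝ → ℝ) (hF : Continuous (fun p : ℝ × ℝ => F p.1 p.2))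
    (hG : Continuous (fun p : ℝ × ℝ => G p.1 p.2)) (a b c d r s : ℝ) :
    ∫ x in a..b, ∫ y in c..d, (r * F x y + s * G x y) =
      r * (∫ x in a..b, ∫ y in c..d, F x y) + s * ∫ x in a..b, ∫ y in c..d, G x y := by
  have h1 : ∀ x, ∫ y in c..d, (r * F x y + s * G x y) =
      r * (∫ y in c..d, F x y) + s * ∫ y in c..d, G x y := by
    intro x
    have hFx : Continuous (fun y => F x y) :=
      hF.comp (by fun_prop : Continuous (fun y : ℝ => (x, y)))
    have hGx : Continuous (fun y => G x y) :=
      hG.comp (by fun_prop : Continuous (fun y : ℝ => (x, y)))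
    rw [intervalIntegral.integral_add
      ((hFx.intervalIntegrable _ _).const_mul r) ((hGx.intervalIntegrable _ _).const_mul s),
      intervalIntegral.integral_const_mul, intervalIntegral.integral_const_mul]
  simp_rw [h1]
  rw [intervalIntegral.integral_add
      (((cont_x F hF c d).intervalIntegrable _ _).const_mul r)
      (((cont_x G hG c d).intervalIntegrable _ _).const_mul s),
      intervalIntegral.integral_const_mul, intervalIntegral.integral_const_mul]

lemma core (a : ℝ) (ha0 : 0 < a) (ha : a ≤ 1/2) (α : ℝ) (hα : 0 < α) (hα' : α ≤ π/6)
    (g gr gp : ℝ → ℝ → ℝ)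
    (hg : Continuous (fun p : ℝ × ℝ => g p.1 p.2))
    (hr : Continuous (fun p : ℝ × ℝ => gr p.1 p.2))
    (hp : Continuous (fun p : ℝ × ℝ => gp p.1 p.2))
    (hdr : ∀ ρ ∈ Ioo a 1, ∀ φ ∈ Icc (π/2 - α) (π/2 + α),
      HasDerivAt (fun s => g s φ) (gr ρ φ) ρ)
    (hdp : ∀ ρ ∈ Icc a 1, ∀ φ ∈ Ioo (π/2 - α) (π/2 + α),
      HasDerivAt (fun t => g ρ t) (gp ρ φ) φ)
    (hmean : (∫ ρ in a..1, ∫ φ in (π/2 - α)..(π/2 + α), ρ^4 * g ρ φ * sin φ ^ 2) = 0) :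
    |∫ ρ in a..1, ∫ φ in (π/2 - α)..(π/2 + α), cos φ * gp ρ φ * g ρ φ|
      ≤ (7/10) * ∫ ρ in a..1, ∫ φ in (π/2 - α)..(π/2 + α),
          (ρ^2 * gr ρ φ ^ 2 + gp ρ φ ^ 2) * sin φ := by
  have hpi := pi_pos
  have ha1 : a ≤ 1 := by linarith
  set b := π/2 - α with hb
  set d := π/2 + α with hd
  have hbd : b ≤ d := by linarith
  have hgx : ∀ φ, Continuous (fun x => g x φ) := fun φ =>
    hg.comp (by fun_prop : Continuous (fun x : ℝ => (x, φ)))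
  have hrx : ∀ φ, Continuous (fun x => gr x φ) := fun φ =>
    hr.comp (by fun_prop : Continuous (fun x : ℝ => (x, φ)))
  have hgy : ∀ x, Continuous (fun φ => g x φ) := fun x =>
    hg.comp (by fun_prop : Continuous (fun φ : ℝ => (x, φ)))
  have hpy : ∀ x, Continuous (fun φ => gp x φ) := fun x =>
    hp.comp (by fun_prop : Continuous (fun φ : ℝ => (x, φ)))
  have hg2 : Continuous (fun p : ℝ × ℝ => g p.1 (π/2)) :=
    hg.comp (by fun_prop : Continuous (fun p : ℝ × ℝ => (p.1, π/2)))
  -- trigonometric bounds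
  have hsin : ∀ φ ∈ Icc b d, √3/2 ≤ sin φ := by
    intro φ hφ
    rw [← cos_pi_div_six, ← cos_sub_pi_div_two, ← cos_abs (φ - π/2)]
    apply cos_le_cos_of_nonneg_of_le_pi (abs_nonneg _) (by linarith)
    rw [abs_le]; constructor <;> linarith [hφ.1, hφ.2]
  have h3 : (√3)^2 = 3 := by norm_num
  have h3p : 0 < √3 := by positivity
  have hsin0 : ∀ φ ∈ Icc b d, 0 ≤ sin φ := fun φ hφ => by linarith [hsin φ hφ]
  have hcos : ∀ φ ∈ Icc b d, 3 * cos φ ^ 2 ≤ sin φ ^ 2 := by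
    intro φ hφ
    have := hsin φ hφ
    nlinarith [sin_sq_add_cos_sq φ]
  set X := ∫ ρ in a..1, ∫ φ in b..d, g ρ φ ^ 2 * sin φ with hX
  set A := ∫ ρ in a..1, ∫ φ in b..d, ρ^2 * gr ρ φ ^ 2 * sin φ with hA
  set B := ∫ ρ in a..1, ∫ φ in b..d, gp ρ φ ^ 2 * sin φ with hB
  have hA0 : 0 ≤ A := intervalIntegral.integral_nonneg ha1 fun x hx =>
    intervalIntegral.integral_nonneg hbd fun y hy => mul_nonneg (by positivity) (hsin0 y hy)
  have hB0 : 0 ≤ B := intervalIntegral.integral_nonneg ha1 fun x hx =>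
    intervalIntegral.integral_nonneg hbd fun y hy => mul_nonneg (by positivity) (hsin0 y hy)
  set c : ℝ → ℝ := fun φ => ∫ ρ in a..1, ρ^4 * g ρ φ with hc
  have hcc : Continuous c := cont_y (fun ρ φ => ρ^4 * g ρ φ) (by fun_prop) a 1
  set C := ∫ φ in b..d, c φ ^ 2 * sin φ with hC
  -- Hardy
  have H1 : X ≤ (130/27) * A + (175/3) * C := by
    rw [hX, hA, swap_aux (fun ρ φ => g ρ φ ^ 2 * sin φ) (by fun_prop),
      swap_aux (fun ρ φ => ρ^2 * gr ρ φ ^ 2 * sin φ) (by fun_prop), hC,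
      ← intervalIntegral.integral_const_mul, ← intervalIntegral.integral_const_mul]
    have k1 : Continuous fun φ => ∫ ρ in a..1, g ρ φ ^ 2 * sin φ :=
      cont_y (fun ρ φ => g ρ φ ^ 2 * sin φ) (by fun_prop) a 1
    have k2 : Continuous fun φ => ∫ ρ in a..1, ρ^2 * gr ρ φ ^ 2 * sin φ :=
      cont_y (fun ρ φ => ρ^2 * gr ρ φ ^ 2 * sin φ) (by fun_prop) a 1
    rw [← intervalIntegral.integral_add
      (Continuous.intervalIntegrable (by fun_prop) _ _)
      (Continuous.intervalIntegrable (by fun_prop) _ _)]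
    apply intervalIntegral.integral_mono_on hbd (k1.intervalIntegrable _ _)
      (Continuous.intervalIntegrable (by fun_prop) _ _)
    intro φ hφ
    rw [intervalIntegral.integral_mul_const, intervalIntegral.integral_mul_const]
    have := hardy_aux a ha0 ha (fun x => g x φ) (fun x => gr x φ) (hgx φ).continuousOn
      (hrx φ).continuousOn (fun x hx => hdr x hx φ hφ)
    have := mul_le_mul_of_nonneg_right this (hsin0 φ hφ)
    simp only [hc]
    linarith
  -- Poincare
  have H2 : (√3/2) * C ≤ (1/9) * (1/2.94^2) * B := by
    have s1 : (√3/2) * C ≤ ∫ φ in b..d, c φ ^ 2 * sin φ ^ 2 := by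
      rw [hC, ← intervalIntegral.integral_const_mul]
      apply intervalIntegral.integral_mono_on hbd
        (Continuous.intervalIntegrable (by fun_prop) _ _)
        (Continuous.intervalIntegrable (by fun_prop) _ _)
      intro φ hφ
      have := mul_le_mul_of_nonneg_right (hsin φ hφ) (mul_nonneg (sq_nonneg (c φ)) (hsin0 φ hφ))
      linarith
    have s2 : ∫ φ in b..d, c φ * sin φ ^ 2 = 0 := by
      rw [← hmean, swap_aux (fun ρ φ => ρ^4 * g ρ φ * sin φ ^ 2) (by fun_prop)]
      simp only [hc, intervalIntegral.integral_mul_const]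
    have s3 : ∫ φ in b..d, c φ ^ 2 * sin φ ^ 2 ≤ ∫ φ in b..d, (c φ - c (π/2)) ^ 2 * sin φ := by
      have : ∫ φ in b..d, c φ ^ 2 * sin φ ^ 2
          = ∫ φ in b..d, (c φ ^ 2 * sin φ ^ 2 - 2 * c (π/2) * (c φ * sin φ ^ 2)) := by
        rw [intervalIntegral.integral_sub (Continuous.intervalIntegrable (by fun_prop) _ _)
          (Continuous.intervalIntegrable (by fun_prop) _ _),
          intervalIntegral.integral_const_mul, s2]
        simp
      rw [this]
      apply intervalIntegral.integral_mono_on hbd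
        (Continuous.intervalIntegrable (by fun_prop) _ _)
        (Continuous.intervalIntegrable (by fun_prop) _ _)
      intro φ hφ
      have t1 : sin φ ^ 2 ≤ sin φ := by nlinarith [hsin0 φ hφ, sin_le_one φ]
      have t2 := mul_le_mul_of_nonneg_left t1 (sq_nonneg (c φ - c (π/2)))
      nlinarith [sq_nonneg (c (π/2) * sin φ)]
    have s4 : ∫ φ in b..d, (c φ - c (π/2)) ^ 2 * sin φ ≤
        (1/9) * ∫ φ in b..d, ∫ ρ in a..1, (g ρ φ - g ρ (π/2))^2 * sin φ := by
      rw [← intervalIntegral.integral_const_mul]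
      have k1 : Continuous fun φ => ∫ ρ in a..1, (g ρ φ - g ρ (π/2))^2 * sin φ :=
        cont_y (fun ρ φ => (g ρ φ - g ρ (π/2))^2 * sin φ) (by fun_prop) a 1
      apply intervalIntegral.integral_mono_on hbd
        (Continuous.intervalIntegrable (by fun_prop) _ _)
        (Continuous.intervalIntegrable (by fun_prop) _ _)
      intro φ hφ
      have hgx1 := hgx φ
      have hgx2 := hgx (π/2)
      have t := cs_aux a ha1 (fun x => x^4) (fun x => g x φ - g x (π/2)) (by fun_prop)
        (by fun_prop) (by
          have := pow8_aux a ha0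
          simpa only [← pow_mul] using this)
      have t2 : ∫ x in a..1, x^4 * (g x φ - g x (π/2)) = c φ - c (π/2) := by
        simp only [hc, mul_sub]
        rw [intervalIntegral.integral_sub (Continuous.intervalIntegrable (by fun_prop) _ _)
          (Continuous.intervalIntegrable (by fun_prop) _ _)]
      rw [t2] at t
      rw [intervalIntegral.integral_mul_const, ← mul_assoc]
      exact mul_le_mul_of_nonneg_right t (hsin0 φ hφ)
    have s5 : ∫ φ in b..d, ∫ ρ in a..1, (g ρ φ - g ρ (π/2))^2 * sin φ ≤ (1/2.94^2) * B := by
      rw [← swap_aux (fun ρ φ => (g ρ φ - g ρ (π/2))^2 * sin φ) (by fun_prop), hB,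
        ← intervalIntegral.integral_const_mul]
      apply intervalIntegral.integral_mono_on ha1
        ((cont_x (fun ρ φ => (g ρ φ - g ρ (π/2))^2 * sin φ) (by fun_prop) _ _).intervalIntegrable _ _)
        (((cont_x (fun ρ φ => gp ρ φ ^2 * sin φ) (by fun_prop) _ _).intervalIntegrable _ _).const_mul _)
      intro x hx
      have := poincare_aux α hα hα' (fun φ => g x φ) (fun φ => gp x φ) (hgy x).continuousOn
        (hpy x).continuousOn (fun φ hφ => hdp x hx φ hφ)
      norm_num at this ⊢
      linarith
    linarith
  -- conclusion
  have hE : ∫ ρ in a..1, ∫ φ in b..d, (ρ^2 * gr ρ φ ^ 2 + gp ρ φ ^ 2) * sin φ = A + B := by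
    have := dlin (fun ρ φ => ρ^2 * gr ρ φ ^ 2 * sin φ) (fun ρ φ => gp ρ φ ^2 * sin φ)
      (by fun_prop) (by fun_prop) a 1 b d 1 1
    simp only [one_mul] at this
    rw [hA, hB, ← this]
    simp only [add_mul]
  set l : ℝ := 189/650 with hl
  have hU := dlin (fun ρ φ => g ρ φ ^ 2 * sin φ) (fun ρ φ => gp ρ φ ^2 * sin φ)
      (by fun_prop) (by fun_prop) a 1 b d (l/2) (1/(6*l))
  have hL := dlin (fun ρ φ => g ρ φ ^ 2 * sin φ) (fun ρ φ => gp ρ φ ^2 * sin φ)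
      (by fun_prop) (by fun_prop) a 1 b d (-(l/2)) (-(1/(6*l)))
  have pt : ∀ φ ∈ Icc b d, ∀ p q : ℝ, |cos φ * p * q| ≤
      l/2 * (q^2 * sin φ) + 1/(6*l) * (p^2 * sin φ) := by
    intro φ hφ p q
    have hs := hsin φ hφ
    have hs0 : 0 < sin φ := by linarith
    have hc2 := hcos φ hφ
    have h1 : |√3 * cos φ| ≤ sin φ := by
      apply abs_le_of_sq_le_sq _ hs0.le
      rw [mul_pow, h3]; exact hc2
    have h2 : |cos φ * p * q| = |√3 * cos φ| * (|p| * |q| / √3) := by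
      rw [abs_mul, abs_mul, abs_mul, abs_of_pos h3p]; field_simp
    rw [h2]
    have h4 : |p| * |q| / √3 ≤ l/2 * q^2 + 1/(6*l) * p^2 := by
      rw [div_le_iff₀ h3p]
      have h5 : l/2 * q^2 + 1/(6*l) * p^2 - |p| * |q| * √3 / 3 = (l/2) * (|q| - √3/(3*l) * |p|)^2 := by
        have : l ≠ 0 := by norm_num [hl]
        rw [← sq_abs p, ← sq_abs q]
        field_simp
        ring_nf
        rw [h3]; ring
      have h6 : 0 ≤ l/2 * q^2 + 1/(6*l) * p^2 - |p| * |q| * √3 / 3 := by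
        rw [h5]; apply mul_nonneg _ (sq_nonneg _); norm_num [hl]
      nlinarith
    calc |√3 * cos φ| * (|p| * |q| / √3) ≤ sin φ * (l/2 * q^2 + 1/(6*l) * p^2) :=
          mul_le_mul h1 h4 (by positivity) hs0.le
      _ = _ := by ring
  have hu := dmono (fun ρ φ => cos φ * gp ρ φ * g ρ φ)
    (fun ρ φ => l/2 * (g ρ φ ^ 2 * sin φ) + 1/(6*l) * (gp ρ φ ^2 * sin φ))
    (by fun_prop) (by fun_prop) a 1 b d ha1 hbd
    (fun x hx y hy => (abs_le.1 (pt y hy _ _)).2)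
  have hlo := dmono 
    (fun ρ φ => -(l/2) * (g ρ φ ^ 2 * sin φ) + -(1/(6*l)) * (gp ρ φ ^2 * sin φ))
    (fun ρ φ => cos φ * gp ρ φ * g ρ φ)
    (by fun_prop) (by fun_prop) a 1 b d ha1 hbd
    (fun x hx y hy => by have := (abs_le.1 (pt y hy (gp x y) (g x y))).1; linarith)
  rw [hU] at hu
  rw [hL] at hlo
  rw [hE]
  have fin : l/2 * X + 1/(6*l) * B ≤ 7/10 * (A + B) := by
    have h7 : (1.732:ℝ) ≤ √3 := Real.le_sqrt_of_sq_le (by norm_num)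
    have hC0 : 0 ≤ C := intervalIntegral.integral_nonneg hbd fun y hy =>
      mul_nonneg (sq_nonneg _) (hsin0 y hy)
    have h8 : 0.866 * C ≤ (1/9) * (1/2.94^2) * B := by nlinarith
    rw [hl]
    norm_num at h8 H1 ⊢
    linarith
  rw [abs_le]
  constructor
  · linarith
  · linarith

open MeasureTheory Real Set

/-- On `D_m = {1/m < ρ < 1, π/2-α < φ < π/2+α}` (`dx = 2πρ² sin φ dρ dφ`), if
`∫ ρ² sin φ · g dx = 0`, then
`|∫ cot φ (ρ⁻¹∂_φ g)(g/ρ) dx| ≤ 0.7 ∫ (|∂_ρ g|² + |ρ⁻¹∂_φ g|²) dx`. -/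
theorem cot_cross_term_bound (m : ℕ) (hm : 1000 ≤ m) (α : ℝ) (hα : 0 < α) (hα' : α ≤ π/6)
    (g gr gp : ℝ → ℝ → ℝ)
    (hcf : ContinuousOn (fun p : ℝ × ℝ => g p.1 p.2)
      (Set.Icc (1/(m:ℝ)) 1 ×ˢ Set.Icc (π/2 - α) (π/2 + α)))
    (hcr : ContinuousOn (fun p : ℝ × ℝ => gr p.1 p.2)
      (Set.Icc (1/(m:ℝ)) 1 ×ˢ Set.Icc (π/2 - α) (π/2 + α)))
    (hcp : ContinuousOn (fun p : ℝ × ℝ => gp p.1 p.2)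
      (Set.Icc (1/(m:ℝ)) 1 ×ˢ Set.Icc (π/2 - α) (π/2 + α)))
    (hdr : ∀ ρ ∈ Set.Icc (1/(m:ℝ)) 1, ∀ φ ∈ Set.Icc (π/2 - α) (π/2 + α),
      HasDerivAt (fun s => g s φ) (gr ρ φ) ρ)
    (hdp : ∀ ρ ∈ Set.Icc (1/(m:ℝ)) 1, ∀ φ ∈ Set.Icc (π/2 - α) (π/2 + α),
      HasDerivAt (fun t => g ρ t) (gp ρ φ) φ)
    (hmean : (∫ ρ in (1/(m:ℝ))..1, ∫ φ in (π/2 - α)..(π/2 + α),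
        (ρ^2 * Real.sin φ * g ρ φ) * (2*π*ρ^2*Real.sin φ)) = 0) :
    |∫ ρ in (1/(m:ℝ))..1, ∫ φ in (π/2 - α)..(π/2 + α),
        (Real.cos φ / Real.sin φ) * (gp ρ φ / ρ) * (g ρ φ / ρ) * (2*π*ρ^2*Real.sin φ)|
      ≤ (7/10) * ∫ ρ in (1/(m:ℝ))..1, ∫ φ in (π/2 - α)..(π/2 + α),
          (gr ρ φ ^ 2 + (gp ρ φ / ρ) ^ 2) * (2*π*ρ^2*Real.sin φ) := by
  have hm' : (1000:ℝ) ≤ m := by exact_mod_cast hm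
  set a : ℝ := 1/(m:ℝ) with ha
  have ha0 : 0 < a := by positivity
  have ha2 : a ≤ 1/2 := by
    rw [ha, div_le_div_iff₀ (by linarith) (by norm_num)]; linarith
  have ha1 : a ≤ 1 := by linarith
  have hpi := pi_pos
  have hbd : π/2 - α ≤ π/2 + α := by linarith
  let P : ℝ × ℝ → ℝ × ℝ := fun p => (max a (min 1 p.1), max (π/2 - α) (min (π/2 + α) p.2))
  have hP : Continuous P := by fun_prop
  have hPm : ∀ p, P p ∈ Icc a 1 ×ˢ Icc (π/2 - α) (π/2 + α) := fun p =>
    ⟨⟨le_max_left _ _, max_le ha1 (min_le_left _ _)⟩,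
      ⟨le_max_left _ _, max_le hbd (min_le_left _ _)⟩⟩
  have hPe : ∀ x ∈ Icc a 1, ∀ y ∈ Icc (π/2 - α) (π/2 + α), P (x, y) = (x, y) := by
    intro x hx y hy
    simp only [P]
    rw [min_eq_right hx.2, max_eq_right hx.1, min_eq_right hy.2, max_eq_right hy.1]
  let E : (ℝ → ℝ → ℝ) → ℝ → ℝ → ℝ := fun f x y => f (P (x, y)).1 (P (x, y)).2
  have hE : ∀ f x, x ∈ Icc a 1 → ∀ y ∈ Icc (π/2 - α) (π/2 + α), E f x y = f x y := by
    intro f x hx y hy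
    simp only [E]
    rw [hPe x hx y hy]
  have hEc : ∀ f : ℝ → ℝ → ℝ, ContinuousOn (fun p : ℝ × ℝ => f p.1 p.2)
      (Icc a 1 ×ˢ Icc (π/2 - α) (π/2 + α)) → Continuous (fun p : ℝ × ℝ => E f p.1 p.2) :=
    fun f hf => hf.comp_continuous hP hPm
  have congr2 : ∀ F G : ℝ → ℝ → ℝ,
      (∀ x ∈ Icc a 1, ∀ y ∈ Icc (π/2 - α) (π/2 + α), F x y = G x y) →
      ∫ x in a..1, ∫ y in (π/2 - α)..(π/2 + α), F x y
        = ∫ x in a..1, ∫ y in (π/2 - α)..(π/2 + α), G x y := by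
    intro F G h
    apply intervalIntegral.integral_congr
    intro x hx
    rw [uIcc_of_le ha1] at hx
    apply intervalIntegral.integral_congr
    intro y hy
    rw [uIcc_of_le hbd] at hy
    exact h x hx y hy
  have smul2 : ∀ F : ℝ → ℝ → ℝ,
      ∫ x in a..1, ∫ y in (π/2 - α)..(π/2 + α), (2 * π) * F x y
        = (2 * π) * ∫ x in a..1, ∫ y in (π/2 - α)..(π/2 + α), F x y := by
    intro F
    simp only [intervalIntegral.integral_const_mul]
  have e0 := congr2 (fun ρ φ => (ρ^2 * Real.sin φ * g ρ φ) * (2*π*ρ^2*Real.sin φ))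
    (fun ρ φ => (2 * π) * (ρ^4 * E g ρ φ * sin φ ^ 2)) (fun x hx y hy => by
      simp only [hE _ x hx y hy]; ring)
  rw [smul2 (fun ρ φ => ρ^4 * E g ρ φ * sin φ ^ 2)] at e0
  have hmean' := hmean
  rw [e0] at hmean'
  have hmean2 := (mul_eq_zero.1 hmean').resolve_left (by positivity)
  have hsin : ∀ y ∈ Icc (π/2 - α) (π/2 + α), sin y ≠ 0 := fun y hy =>
    (sin_pos_of_pos_of_lt_pi (by linarith [hy.1]) (by linarith [hy.2])).ne'
  have e1 := congr2 (fun ρ φ => (Real.cos φ / Real.sin φ) * (gp ρ φ / ρ) * (g ρ φ / ρ)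
      * (2*π*ρ^2*Real.sin φ))
    (fun ρ φ => (2 * π) * (cos φ * E gp ρ φ * E g ρ φ)) (fun x hx y hy => by
      have h1 : x ≠ 0 := by linarith [hx.1]
      have h2 := hsin y hy
      simp only [hE _ x hx y hy]; field_simp)
  have e2 := congr2 (fun ρ φ => (gr ρ φ ^ 2 + (gp ρ φ / ρ) ^ 2) * (2*π*ρ^2*Real.sin φ))
    (fun ρ φ => (2 * π) * ((ρ^2 * E gr ρ φ ^ 2 + E gp ρ φ ^ 2) * sin φ)) (fun x hx y hy => by
      have h1 : x ≠ 0 := by linarith [hx.1]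
      simp only [hE _ x hx y hy]; field_simp)
  rw [smul2 (fun ρ φ => cos φ * E gp ρ φ * E g ρ φ)] at e1
  rw [smul2 (fun ρ φ => (ρ^2 * E gr ρ φ ^ 2 + E gp ρ φ ^ 2) * sin φ)] at e2
  have hcore := core a ha0 ha2 α hα hα' (E g) (E gr) (E gp) (hEc g hcf) (hEc gr hcr) (hEc gp hcp)
    (fun x hx y hy => by
      rw [hE gr x (Ioo_subset_Icc_self hx) y hy]
      refine (hdr x (Ioo_subset_Icc_self hx) y hy).congr_of_eventuallyEq ?_
      filter_upwards [Icc_mem_nhds hx.1 hx.2] with s hs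
      exact hE g s hs y hy)
    (fun x hx y hy => by
      rw [hE gp x hx y (Ioo_subset_Icc_self hy)]
      refine (hdp x hx y (Ioo_subset_Icc_self hy)).congr_of_eventuallyEq ?_
      filter_upwards [Icc_mem_nhds hy.1 hy.2] with s hs
      exact hE g x hx s hs)
    hmean2
  rw [e1, e2, abs_mul, abs_of_pos (by positivity : 0 < 2 * π)]
  have := mul_le_mul_of_nonneg_left hcore (by positivity : 0 ≤ 2 * π)
  linarith
end
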